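/- Let L be a countable set, l : L → ℝ a function with l(γ) ≥ l₀ for all γ ∈ L for some constant l₀ > 0, and let w, v : L → [0,∞) be two weights. Assume there are constants C > 0 and ε > 0 and a function r : L × ℕ≥1 → ℝ such that v(γ)^k = w(γ)^k·(1 + r(γ,k)) and |r(γ,k)| ≤ C·e^{−ε·k·l(γ)} for all γ ∈ L and k ≥ 1. Let η > 0 and assume: (a) for every real σ > η the double series Σ_{γ∈L} Σ_{k≥1} w(γ)^k · e^{−k·σ·l(γ)}/k converges, so that Z_w(s) := exp( Σ_{γ,k} w(γ)^k e^{−ksl(γ)}/k ) is defined and analytic on {Re(s) > η}; and (b) there exist an open set U ⊆ ℂ containing {s : Re(s) ≥ η} and an analytic, nowhere-vanishing function g on U with Z_w(s) = g(s)/(s−η) for every s ∈ U with Re(s) > η. Then both weighted counting functions satisfy the same asymptotics: Σ_{(γ,k) with k·l(γ) ≤ T} w(γ)^k ∼ e^{ηT}/(ηT) and Σ_{(γ,k) with k·l(γ) ≤ T} v(γ)^k ∼ e^{ηT}/(ηT) as T → ∞. -/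

import Mathlib

/-- The logarithm of the weighted dynamical zeta function:
`F(s) = Σ_{γ∈L} Σ_{k≥1} u(γ)^k e^{-k s l(γ)} / k`, where `k = p.2 + 1`. -/
noncomputable def zetaLog {L : Type*} (l u : L → ℝ) (s : ℂ) : ℂ :=
  ∑' p : L × ℕ, (u p.1 : ℂ) ^ (p.2 + 1) *
    Complex.exp (-((p.2 : ℂ) + 1) * s * (l p.1 : ℂ)) / ((p.2 : ℂ) + 1)

section Helpers

open Real Set Filter Topology MeasureTheory



/-- The Fejér kernel (up to normalisation). -/
noncomputable def fejK (lam u : ℝ) : ℝ := lam * (Real.sinc (lam * u / 2)) ^ 2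

lemma fejK_nonneg {lam : ℝ} (h : 0 < lam) (u : ℝ) : 0 ≤ fejK lam u := by
  unfold fejK; positivity

lemma fejK_cont (lam : ℝ) : Continuous (fejK lam) := by
  unfold fejK
  have := Real.continuous_sinc
  fun_prop

lemma sinc_sq_le (x : ℝ) : (Real.sinc x) ^ 2 ≤ 2 * (1 + x ^ 2)⁻¹ := by
  have h1 : (Real.sinc x) ^ 2 ≤ 1 := by
    rw [sq_le_one_iff_abs_le_one]; exact Real.abs_sinc_le_one x
  have h2 : x ^ 2 * (Real.sinc x) ^ 2 ≤ 1 := by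
    by_cases hx : x = 0
    · simp [hx]
    · rw [Real.sinc_of_ne_zero hx, div_pow]
      field_simp
      exact Real.sin_sq_le_one x
  rw [← div_eq_mul_inv, le_div_iff₀ (by positivity)]
  nlinarith

lemma sinc_sq_integrable : Integrable (fun x : ℝ => (Real.sinc x) ^ 2) := by
  refine Integrable.mono' (integrable_inv_one_add_sq.const_mul 2) ?_ ?_
  · exact (Real.continuous_sinc.pow 2).aestronglyMeasurable
  · refine Eventually.of_forall fun x => ?_
    rw [Real.norm_of_nonneg (sq_nonneg _)]
    exact sinc_sq_le x

lemma fejK_integrable {lam : ℝ} (h : 0 < lam) : Integrable (fejK lam) := by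
  have := (sinc_sq_integrable.comp_mul_left' (R := lam / 2) (by positivity)).const_mul lam
  refine this.congr (Eventually.of_forall fun x => ?_)
  simp only [fejK]
  congr 3; ring

lemma fejK_half (lam : ℝ) {c : ℂ} (hlam : 0 < lam) (hc : c ≠ 0) :
    ∫ t in (0:ℝ)..lam, ((1 - t / lam : ℝ) : ℂ) * Complex.exp (c * t)
      = Complex.exp (c * lam) / (lam * c ^ 2) - (1 / c + 1 / (lam * c ^ 2)) := by
  have hl : (lam : ℂ) ≠ 0 := by exact_mod_cast hlam.ne'
  have hd : ∀ t ∈ uIcc 0 lam, HasDerivAt (fun t : ℝ =>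
      ((1 - t / lam : ℝ) : ℂ) * Complex.exp (c * t) / c + Complex.exp (c * t) / (lam * c ^ 2))
      (((1 - t / lam : ℝ) : ℂ) * Complex.exp (c * t)) t := by
    intro t _
    have h1 : HasDerivAt (fun t : ℝ => Complex.exp (c * t)) (Complex.exp (c * t) * (c * 1)) t := by
      exact (HasDerivAt.cexp ((hasDerivAt_id t).ofReal_comp.const_mul c))
    have h2 : HasDerivAt (fun t : ℝ => ((1 - t / lam : ℝ) : ℂ)) ((-(1 / lam) : ℝ) : ℂ) t := by
      have : HasDerivAt (fun t : ℝ => (1 - t / lam : ℝ)) (-(1 / lam)) t :=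
        ((hasDerivAt_id t).div_const lam).const_sub 1
      exact this.ofReal_comp
    have := ((h2.mul h1).div_const c).add (h1.div_const (lam * c ^ 2))
    refine this.congr_deriv ?_
    push_cast
    field_simp
    ring
  rw [intervalIntegral.integral_eq_sub_of_hasDerivAt hd
    (Continuous.intervalIntegrable (by fun_prop) _ _)]
  simp [hlam.ne']
  try ring

lemma fejK_fourier (lam : ℝ) (hlam : 0 < lam) (u : ℝ) :
    ∫ t in (-lam)..lam, ((1 - |t| / lam : ℝ) : ℂ) * Complex.exp (Complex.I * u * t)
      = (fejK lam u : ℂ) := by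
  have hl : (lam : ℂ) ≠ 0 := by exact_mod_cast hlam.ne'
  have hcont : Continuous fun t : ℝ => ((1 - |t| / lam : ℝ) : ℂ) * Complex.exp (Complex.I * u * t) := by
    fun_prop
  rw [← intervalIntegral.integral_add_adjacent_intervals (b := 0)
    (hcont.intervalIntegrable _ _) (hcont.intervalIntegrable _ _)]
  have e1 : ∫ t in (-lam)..0, ((1 - |t| / lam : ℝ) : ℂ) * Complex.exp (Complex.I * u * t)
      = ∫ t in (0:ℝ)..lam, ((1 - t / lam : ℝ) : ℂ) * Complex.exp ((-(Complex.I * u)) * t) := by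
    have := intervalIntegral.integral_comp_neg (a := 0) (b := lam)
      (fun t : ℝ => ((1 - |t| / lam : ℝ) : ℂ) * Complex.exp (Complex.I * u * t))
    rw [neg_zero] at this
    rw [← this]
    refine intervalIntegral.integral_congr fun t ht => ?_
    rw [uIcc_of_le hlam.le] at ht
    simp only [abs_neg, abs_of_nonneg ht.1]
    push_cast
    ring_nf
  have e2 : ∫ t in (0:ℝ)..lam, ((1 - |t| / lam : ℝ) : ℂ) * Complex.exp (Complex.I * u * t)
      = ∫ t in (0:ℝ)..lam, ((1 - t / lam : ℝ) : ℂ) * Complex.exp ((Complex.I * u) * t) := by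
    refine intervalIntegral.integral_congr fun t ht => ?_
    rw [uIcc_of_le hlam.le] at ht
    simp only [abs_of_nonneg ht.1]
  rw [e1, e2]
  by_cases hu : u = 0
  · subst hu
    have : ∫ t in (0:ℝ)..lam, (1 - t / lam : ℝ) = lam / 2 := by
      rw [intervalIntegral.integral_sub (by simp) (Continuous.intervalIntegrable (by fun_prop) _ _),
        intervalIntegral.integral_div]
      simp
      field_simp
      try ring
    simp only [Complex.ofReal_zero, mul_zero, neg_zero, zero_mul, Complex.exp_zero, mul_one]
    rw [intervalIntegral.integral_ofReal, this]
    simp [fejK]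
  · have hc : Complex.I * (u : ℂ) ≠ 0 := by simp [hu]
    rw [fejK_half lam hlam hc, fejK_half lam hlam (neg_ne_zero.mpr hc)]
    have hs : fejK lam u = (2 - 2 * Real.cos (u * lam)) / (lam * u ^ 2) := by
      unfold fejK
      rw [Real.sinc_of_ne_zero (by positivity), div_pow, Real.sin_sq_eq_half_sub]
      field_simp
      
    rw [hs]
    push_cast
    rw [Complex.cos]
    have hu' : (u : ℂ) ≠ 0 := by exact_mod_cast hu
    have e3 : (Complex.I * (u:ℂ)) ^ 2 = - (u:ℂ)^2 := by rw [mul_pow, Complex.I_sq]; ring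
    rw [neg_sq, e3]
    have e4 : Complex.I * (u:ℂ) * lam = u * lam * Complex.I := by ring
    have e5 : -(Complex.I * (u:ℂ)) * lam = -(u * lam) * Complex.I := by ring
    rw [e4, e5]
    field_simp
    ring

lemma fejK_fubini (f : ℝ → ℝ) (σ lam b : ℝ) (hlam : 0 < lam)
    (hf : IntegrableOn (fun x => f x * Real.exp (-σ * x)) (Ioi 0)) :
    ∫ t in (-lam)..lam, (((1 - |t| / lam : ℝ) : ℂ) * Complex.exp (Complex.I * b * t) *
        ∫ x in Ioi (0:ℝ), (f x : ℂ) * Complex.exp (-(σ + t * Complex.I) * x))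
      = ((∫ x in Ioi (0:ℝ), f x * Real.exp (-σ * x) * fejK lam (b - x) : ℝ) : ℂ) := by
  rw [intervalIntegral.integral_of_le (by linarith)]
  have hf' : Integrable (fun x : ℝ => ((f x * Real.exp (-σ * x) : ℝ) : ℂ)) (volume.restrict (Ioi 0)) :=
    hf.ofReal
  have hh : Integrable (fun t : ℝ => ((1 - |t| / lam : ℝ) : ℂ)) (volume.restrict (Ioc (-lam) lam)) := by
    have : Continuous (fun t : ℝ => ((1 - |t| / lam : ℝ) : ℂ)) := by fun_prop
    exact (this.integrableOn_Icc).mono_set Ioc_subset_Icc_self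
  have hp := (hh.mul_prod hf').bdd_mul (c := 1)
    (f := fun z : ℝ × ℝ => Complex.exp ((((b - z.2) * z.1 : ℝ) : ℂ) * Complex.I))
    (Continuous.aestronglyMeasurable (by fun_prop))
    (Eventually.of_forall fun z => by rw [Complex.norm_exp_ofReal_mul_I])
  have key : ∀ t x : ℝ, ((1 - |t| / lam : ℝ) : ℂ) * Complex.exp (Complex.I * b * t) *
      ((f x : ℂ) * Complex.exp (-(σ + t * Complex.I) * x)) =
      Complex.exp ((((b - x) * t : ℝ) : ℂ) * Complex.I) *
        (((1 - |t| / lam : ℝ) : ℂ) * ((f x * Real.exp (-σ * x) : ℝ) : ℂ)) := by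
    intro t x
    have : Complex.exp (Complex.I * b * t) * Complex.exp (-(σ + t * Complex.I) * x) =
        Complex.exp ((((b - x) * t : ℝ) : ℂ) * Complex.I) * Complex.exp (-σ * x) := by
      rw [← Complex.exp_add, ← Complex.exp_add]; congr 1; push_cast; ring
    push_cast at this ⊢
    linear_combination (1 - ((|t| : ℝ) : ℂ) / lam) * (f x : ℂ) * this
  have hswap := integral_integral_swap (f := fun t x => ((1 - |t| / lam : ℝ) : ℂ) * Complex.exp (Complex.I * b * t) *
      ((f x : ℂ) * Complex.exp (-(σ + t * Complex.I) * x)))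
      (μ := volume.restrict (Ioc (-lam) lam)) (ν := volume.restrict (Ioi 0))
      (hp.congr (Eventually.of_forall fun z => (key z.1 z.2).symm))
  have e0 : ∀ t : ℝ, (((1 - |t| / lam : ℝ) : ℂ) * Complex.exp (Complex.I * b * t) *
        ∫ x in Ioi (0:ℝ), (f x : ℂ) * Complex.exp (-(σ + t * Complex.I) * x)) = 
      ∫ x in Ioi (0:ℝ), ((1 - |t| / lam : ℝ) : ℂ) * Complex.exp (Complex.I * b * t) *
      ((f x : ℂ) * Complex.exp (-(σ + t * Complex.I) * x)) := fun t => (integral_const_mul _ _).symm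
  simp_rw [e0]
  rw [hswap, ← integral_complex_ofReal]
  refine integral_congr_ae (Eventually.of_forall fun x => ?_)
  beta_reduce
  rw [← intervalIntegral.integral_of_le (by linarith)]
  push_cast
  rw [← fejK_fourier lam hlam, ← intervalIntegral.integral_const_mul]
  refine intervalIntegral.integral_congr fun t _ => ?_
  have hk := key t x
  push_cast at hk ⊢
  rw [hk]
  have : (b - (x:ℂ)) * t * Complex.I = Complex.I * (b - x) * t := by ring
  rw [this]; ring

lemma exp_laplace (η A : ℝ) (s : ℂ) (hs : η < s.re) :
    IntegrableOn (fun x : ℝ => ((A * Real.exp (η * x) : ℝ) : ℂ) * Complex.exp (-s * x)) (Ioi 0) ∧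
    ∫ x in Ioi (0:ℝ), ((A * Real.exp (η * x) : ℝ) : ℂ) * Complex.exp (-s * x) = A / (s - η) := by
  have e : ∀ x : ℝ, ((A * Real.exp (η * x) : ℝ) : ℂ) * Complex.exp (-s * x) =
      A * Complex.exp ((η - s) * x) := by
    intro x; push_cast; rw [mul_assoc, ← Complex.exp_add]; ring_nf
  have hre : ((η : ℂ) - s).re < 0 := by simp; linarith
  simp_rw [e]
  refine ⟨(integrableOn_exp_mul_complex_Ioi hre 0).const_mul _, ?_⟩
  rw [integral_const_mul, integral_exp_mul_complex_Ioi hre]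
  have : (η : ℂ) - s ≠ 0 := fun h => by rw [h] at hre; simp at hre
  have h2 : s - η ≠ 0 := fun h => this (by linear_combination -h)
  simp
  field_simp
  ring

lemma WI_identity (ψ : ℝ → ℝ) (η A : ℝ) 
    (hint : ∀ σ, η < σ → IntegrableOn (fun x => ψ x * Real.exp (-σ * x)) (Ioi 0))
    (G : ℂ → ℂ)
    (hF : ∀ s : ℂ, η < s.re → ∫ x in Ioi (0:ℝ), (ψ x : ℂ) * Complex.exp (-s * x) = A / (s - η) + G s)
    (lam : ℝ) (hlam : 0 < lam) (b σ : ℝ) (hσ : η < σ) :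
    IntegrableOn (fun x => ψ x * Real.exp (-σ * x) * fejK lam (b - x)) (Ioi 0) ∧
    ∫ x in Ioi (0:ℝ), ψ x * Real.exp (-σ * x) * fejK lam (b - x) =
      A * (∫ x in Ioi (0:ℝ), Real.exp (-(σ - η) * x) * fejK lam (b - x)) +
      (∫ t in (-lam)..lam, ((1 - |t| / lam : ℝ) : ℂ) * Complex.exp (Complex.I * b * t) *
        G (σ + t * Complex.I)).re := by
  have hlap := fun t : ℝ => exp_laplace η A (σ + t * Complex.I) (by simpa using hσ)
  have hi2 : IntegrableOn (fun x => (A * Real.exp (η * x)) * Real.exp (-σ * x)) (Ioi 0) := by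
    have := (hlap 0).1.re
    refine this.congr (Eventually.of_forall fun x => ?_)
    simp only [Complex.ofReal_zero, zero_mul, add_zero]
    rw [← Complex.ofReal_neg, ← Complex.ofReal_mul, ← Complex.ofReal_exp, ← Complex.ofReal_mul]
    exact Complex.ofReal_re _
  have hmeas : AEStronglyMeasurable (fun x => fejK lam (b - x)) (volume.restrict (Ioi 0)) :=
    ((fejK_cont lam).comp (continuous_const.sub continuous_id)).aestronglyMeasurable
  have hbd : ∀ x, ‖fejK lam (b - x)‖ ≤ lam := by
    intro x
    rw [Real.norm_of_nonneg (fejK_nonneg hlam _)]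
    unfold fejK
    have : (Real.sinc (lam * (b - x) / 2)) ^ 2 ≤ 1 := by
      rw [sq_le_one_iff_abs_le_one]; exact Real.abs_sinc_le_one _
    nlinarith
  have hI : ∀ {f : ℝ → ℝ}, IntegrableOn f (Ioi 0) →
      IntegrableOn (fun x => f x * fejK lam (b - x)) (Ioi 0) := by
    intro f hf
    have := hf.bdd_mul hmeas (Eventually.of_forall hbd)
    exact this.congr (Eventually.of_forall fun x => mul_comm _ _)
  refine ⟨hI (hint σ hσ), ?_⟩
  have hsub : IntegrableOn (fun x => (ψ x - A * Real.exp (η * x)) * Real.exp (-σ * x)) (Ioi 0) := by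
    refine ((hint σ hσ).sub hi2).congr (Eventually.of_forall fun x => ?_)
    simp; ring
  have h := fejK_fubini (fun x => ψ x - A * Real.exp (η * x)) σ lam b hlam hsub
  have hG : ∀ t : ℝ, ∫ x in Ioi (0:ℝ), ((ψ x - A * Real.exp (η * x) : ℝ) : ℂ) *
      Complex.exp (-(σ + t * Complex.I) * x) = G (σ + t * Complex.I) := by
    intro t
    have h1 := hF (σ + t * Complex.I) (by simpa using hσ)
    have h2 := hlap t
    have h3 : IntegrableOn (fun x : ℝ => (ψ x : ℂ) * Complex.exp (-(σ + t * Complex.I) * x)) (Ioi 0) := by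
      have := (hint σ hσ).ofReal (𝕜 := ℂ)
      have := this.bdd_mul (c := 1)
        (f := fun x : ℝ => Complex.exp (((-t * x : ℝ) : ℂ) * Complex.I))
        (Continuous.aestronglyMeasurable (by fun_prop))
        (Eventually.of_forall fun z => by rw [Complex.norm_exp_ofReal_mul_I])
      refine this.congr (Eventually.of_forall fun x => ?_)
      simp only
      push_cast
      have e : Complex.exp (-(σ + t * Complex.I) * x) = Complex.exp (-t * x * Complex.I) * Complex.exp (-σ * x) := by
        rw [← Complex.exp_add]; ring_nf
      rw [e]
      simp
      ring
    have h4 := integral_sub h3 h2.1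
    rw [h1, h2.2] at h4
    rw [show G (σ + t * Complex.I) = A / ((σ + t * Complex.I) - η) + G (σ + t * Complex.I) - A / ((σ + t * Complex.I) - η) by ring, ← h4]
    refine integral_congr_ae (Eventually.of_forall fun x => ?_)
    simp only
    push_cast
    ring
  simp_rw [hG] at h
  rw [h, Complex.ofReal_re]
  have h5 := integral_sub (hI (hint σ hσ)) (hI hi2)
  have h6 : ∫ x in Ioi (0:ℝ), (A * Real.exp (η * x)) * Real.exp (-σ * x) * fejK lam (b - x) =
     A * (∫ x in Ioi (0:ℝ), Real.exp (-(σ - η) * x) * fejK lam (b - x)) := by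
    rw [← integral_const_mul]
    refine integral_congr_ae (Eventually.of_forall fun x => ?_)
    simp only
    rw [mul_assoc A, ← Real.exp_add]
    ring_nf
  rw [← h6, ← sub_eq_iff_eq_add', ← h5]
  refine integral_congr_ae (Eventually.of_forall fun x => ?_)
  simp only
  ring

lemma WI_fixed (ψ : ℝ → ℝ) (hnn : ∀ x, 0 ≤ ψ x) (η A : ℝ) 
    (hint : ∀ σ, η < σ → IntegrableOn (fun x => ψ x * Real.exp (-σ * x)) (Ioi 0))
    (G : ℂ → ℂ) (hG : ContinuousOn G {s | η ≤ s.re})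
    (hF : ∀ s : ℂ, η < s.re → ∫ x in Ioi (0:ℝ), (ψ x : ℂ) * Complex.exp (-s * x) = A / (s - η) + G s)
    (lam : ℝ) (hlam : 0 < lam) (b : ℝ) :
    IntegrableOn (fun x => ψ x * Real.exp (-η * x) * fejK lam (b - x)) (Ioi 0) ∧
    ∫ x in Ioi (0:ℝ), ψ x * Real.exp (-η * x) * fejK lam (b - x) =
      A * (∫ x in Ioi (0:ℝ), fejK lam (b - x)) +
      (∫ t in (-lam)..lam, ((1 - |t| / lam : ℝ) : ℂ) * Complex.exp (Complex.I * b * t) *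
        G (η + t * Complex.I)).re := by
  set σ : ℕ → ℝ := fun n => η + 1 / ((n : ℝ) + 1) with hσdef
  have hσ : ∀ n, η < σ n := fun n => by
    have : 0 < 1 / ((n : ℝ) + 1) := by positivity
    simp only [hσdef]; linarith
  have hσ1 : ∀ n, σ n ≤ η + 1 := fun n => by
    have : 1 / ((n : ℝ) + 1) ≤ 1 := by
      rw [div_le_one (by positivity)]; linarith [(Nat.cast_nonneg n : (0:ℝ) ≤ n)]
    simp only [hσdef]; linarith
  have hσt : Tendsto σ atTop (𝓝 η) := by
    have := (tendsto_one_div_add_atTop_nhds_zero_nat (𝕜 := ℝ)).const_add η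
    simpa [hσdef] using this
  have hid := fun n => WI_identity ψ η A hint G hF lam hlam b (σ n) (hσ n)
  have hKint : Integrable (fun x => fejK lam (b - x)) := (fejK_integrable hlam).comp_sub_left b
  -- first limit
  have l1 : Tendsto (fun n => ∫ x in Ioi (0:ℝ), Real.exp (-(σ n - η) * x) * fejK lam (b - x)) atTop
      (𝓝 (∫ x in Ioi (0:ℝ), fejK lam (b - x))) := by
    refine tendsto_integral_of_dominated_convergence (fun x => fejK lam (b - x)) ?_ hKint.integrableOn ?_ ?_
    · intro n
      have := fejK_cont lam
      exact Continuous.aestronglyMeasurable (by fun_prop)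
    · intro n
      refine (ae_restrict_iff' measurableSet_Ioi).2 (Eventually.of_forall fun x hx => ?_)
      have hx : 0 < x := hx
      have h0 := fejK_nonneg hlam (b - x)
      rw [Real.norm_of_nonneg (by positivity)]
      have : Real.exp (-(σ n - η) * x) ≤ 1 := by
        rw [Real.exp_le_one_iff]
        have := hσ n
        nlinarith
      nlinarith
    · refine Eventually.of_forall fun x => ?_
      have : Tendsto (fun n => Real.exp (-(σ n - η) * x) * fejK lam (b - x)) atTop
          (𝓝 (Real.exp (-(η - η) * x) * fejK lam (b - x))) :=
        ((Real.continuous_exp.tendsto _).comp (((hσt.sub_const η).neg).mul_const x)).mul_const _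
      simpa using this
  -- second limit
  have hcmp : ∃ M, ∀ s ∈ (Icc η (η + 1)) ×ℂ (Icc (-lam) lam), ‖G s‖ ≤ M := by
    have hc : IsCompact ((Icc η (η + 1)) ×ℂ (Icc (-lam) lam)) := isCompact_Icc.reProdIm isCompact_Icc
    exact hc.exists_bound_of_continuousOn (hG.mono fun s hs => hs.1.1)
  obtain ⟨M, hM⟩ := hcmp
  have hGline : ∀ σ, η ≤ σ → Continuous fun t : ℝ => G (σ + t * Complex.I) := by
    intro σ hσ
    have : ContinuousOn (fun t : ℝ => G (σ + t * Complex.I)) univ :=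
      hG.comp (f := fun t : ℝ => (σ + t * Complex.I : ℂ)) (Continuous.continuousOn (by fun_prop))
        (fun t _ => by simpa using hσ)
    exact continuousOn_univ.1 this
  have l2 : Tendsto (fun n => ∫ t in (-lam)..lam, ((1 - |t| / lam : ℝ) : ℂ) * Complex.exp (Complex.I * b * t) *
        G (σ n + t * Complex.I)) atTop (𝓝 (∫ t in (-lam)..lam, ((1 - |t| / lam : ℝ) : ℂ) * Complex.exp (Complex.I * b * t) *
        G (η + t * Complex.I))) := by
    refine intervalIntegral.tendsto_integral_filter_of_dominated_convergence (fun _ => M) ?_ ?_ (by simp) ?_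
    · refine Eventually.of_forall fun n => ?_
      have h := hGline (σ n) (hσ n).le
      have h' : Continuous fun t : ℝ => ((1 - |t| / lam : ℝ) : ℂ) * Complex.exp (Complex.I * b * t) := by
        fun_prop
      exact (h'.mul h).aestronglyMeasurable
    · refine Eventually.of_forall fun n => Eventually.of_forall fun t ht => ?_
      rw [uIoc_of_le (by linarith)] at ht
      have h1 : ‖G (σ n + t * Complex.I)‖ ≤ M := hM _ (by
        constructor
        · simpa using ⟨(hσ n).le, hσ1 n⟩
        · simpa using ⟨ht.1.le, ht.2⟩)
      have h2 : ‖Complex.exp (Complex.I * b * t)‖ = 1 := by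
        rw [show Complex.I * b * t = ((b * t : ℝ) : ℂ) * Complex.I by push_cast; ring, Complex.norm_exp_ofReal_mul_I]
      have h3 : ‖((1 - |t| / lam : ℝ) : ℂ)‖ ≤ 1 := by
        rw [Complex.norm_real, Real.norm_eq_abs, abs_le]
        have : |t| / lam ≤ 1 := by rw [div_le_one hlam, abs_le]; exact ⟨ht.1.le, ht.2⟩
        have : 0 ≤ |t| / lam := by positivity
        constructor <;> linarith
      rw [norm_mul, norm_mul, h2, mul_one]
      have := norm_nonneg (G (σ n + t * Complex.I))
      nlinarith
    · refine Eventually.of_forall fun t _ => ?_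
      refine Tendsto.const_mul _ ?_
      have hw : ContinuousWithinAt G {s | η ≤ s.re} (η + t * Complex.I) := hG _ (by simp)
      refine hw.tendsto.comp (tendsto_nhdsWithin_iff.2 ⟨?_, Eventually.of_forall fun n => ?_⟩)
      · exact ((Complex.continuous_ofReal.tendsto _).comp hσt).add_const _
      · simpa using (hσ n).le
  set u : ℕ → ℝ := fun n => ∫ x in Ioi (0:ℝ), ψ x * Real.exp (-(σ n) * x) * fejK lam (b - x) with hu
  set Lim := A * (∫ x in Ioi (0:ℝ), fejK lam (b - x)) +
      (∫ t in (-lam)..lam, ((1 - |t| / lam : ℝ) : ℂ) * Complex.exp (Complex.I * b * t) *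
        G (η + t * Complex.I)).re with hLim
  have hlim : Tendsto u atTop (𝓝 Lim) := by
    have : u = fun n => A * (∫ x in Ioi (0:ℝ), Real.exp (-(σ n - η) * x) * fejK lam (b - x)) +
      (∫ t in (-lam)..lam, ((1 - |t| / lam : ℝ) : ℂ) * Complex.exp (Complex.I * b * t) *
        G (σ n + t * Complex.I)).re := funext fun n => (hid n).2
    rw [this]
    exact (l1.const_mul A).add ((Complex.continuous_re.tendsto _).comp l2)
  have hpt : ∀ x, Tendsto (fun n => ψ x * Real.exp (-(σ n) * x) * fejK lam (b - x)) atTop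
      (𝓝 (ψ x * Real.exp (-η * x) * fejK lam (b - x))) := fun x =>
    (((Real.continuous_exp.tendsto _).comp ((hσt.neg).mul_const x)).const_mul _).mul_const _
  have hpos : ∀ σ x, 0 ≤ ψ x * Real.exp (-σ * x) * fejK lam (b - x) := fun σ x =>
    mul_nonneg (mul_nonneg (hnn x) (Real.exp_pos _).le) (fejK_nonneg hlam _)
  have hInt : IntegrableOn (fun x => ψ x * Real.exp (-η * x) * fejK lam (b - x)) (Ioi 0) := by
    refine integrable_of_tendsto (Eventually.of_forall hpt) (fun n => (hid n).1.aestronglyMeasurable) ?_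
    have : (fun n => ∫⁻ x in Ioi (0:ℝ), ‖ψ x * Real.exp (-(σ n) * x) * fejK lam (b - x)‖ₑ) =
        fun n => ENNReal.ofReal (u n) := by
      funext n
      rw [hu]
      simp only
      rw [ofReal_integral_eq_lintegral_ofReal (hid n).1 (Eventually.of_forall (hpos _))]
      refine lintegral_congr fun x => ?_
      rw [Real.enorm_of_nonneg (hpos _ _)]
    rw [this, (ENNReal.tendsto_ofReal hlim).liminf_eq]
    exact ENNReal.ofReal_ne_top
  refine ⟨hInt, ?_⟩
  refine tendsto_nhds_unique ?_ hlim
  refine tendsto_integral_of_dominated_convergence _ (fun n => (hid n).1.aestronglyMeasurable) hInt ?_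
    (Eventually.of_forall hpt)
  intro n
  refine (ae_restrict_iff' measurableSet_Ioi).2 (Eventually.of_forall fun x hx => ?_)
  have hx : 0 < x := hx
  rw [Real.norm_of_nonneg (hpos _ _)]
  have h0 := fejK_nonneg hlam (b - x)
  have h1 := hnn x
  have h2 := (hσ n).le
  gcongr

lemma WI_smooth (ψ : ℝ → ℝ) (hnn : ∀ x, 0 ≤ ψ x) (η A : ℝ) 
    (hint : ∀ σ, η < σ → IntegrableOn (fun x => ψ x * Real.exp (-σ * x)) (Ioi 0))
    (G : ℂ → ℂ) (hG : ContinuousOn G {s | η ≤ s.re})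
    (hF : ∀ s : ℂ, η < s.re → ∫ x in Ioi (0:ℝ), (ψ x : ℂ) * Complex.exp (-s * x) = A / (s - η) + G s)
    (lam : ℝ) (hlam : 0 < lam) :
    (∀ b, IntegrableOn (fun x => ψ x * Real.exp (-η * x) * fejK lam (b - x)) (Ioi 0)) ∧
    Tendsto (fun b => ∫ x in Ioi (0:ℝ), ψ x * Real.exp (-η * x) * fejK lam (b - x)) atTop
      (𝓝 (A * ∫ x, fejK lam x)) := by
  have hfix := fun b => WI_fixed ψ hnn η A hint G hG hF lam hlam b
  refine ⟨fun b => (hfix b).1, ?_⟩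
  rw [funext fun b => (hfix b).2]
  rw [show A * ∫ x, fejK lam x = A * (∫ x, fejK lam x) + (0:ℂ).re by simp]
  refine Tendsto.add (Tendsto.const_mul _ ?_) ((Complex.continuous_re.tendsto _).comp ?_)
  · have : (fun b => ∫ x in Ioi (0:ℝ), fejK lam (b - x)) = fun b => ∫ x in Iio b, fejK lam x := by
      funext b
      rw [← integral_indicator measurableSet_Ioi, ← integral_indicator measurableSet_Iio,
        ← integral_sub_left_eq_self _ _ b]
      congr 1
      funext x
      simp [indicator]
    rw [this]
    have h := (aecover_Iio (μ := (volume : Measure ℝ)) (l := atTop) (b := fun b : ℝ => b) tendsto_id)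
    exact h.integral_tendsto_of_countably_generated (fejK_integrable hlam)
  · have hRL := Real.tendsto_integral_exp_smul_cocompact
      (indicator (Ioc (-lam) lam) fun t : ℝ => ((1 - |t| / lam : ℝ) : ℂ) * G (η + t * Complex.I))
    have hb : Tendsto (fun b : ℝ => -(2 * π)⁻¹ * b) atTop (cocompact ℝ) := by
      rw [cocompact_eq_atBot_atTop]
      refine Tendsto.mono_right ?_ le_sup_left
      exact tendsto_id.const_mul_atTop_of_neg (by simp; positivity)
    refine (hRL.comp hb).congr fun b => ?_
    rw [intervalIntegral.integral_of_le (by linarith), ← integral_indicator measurableSet_Ioc]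
    simp only [Function.comp]
    congr 1
    funext t
    by_cases ht : t ∈ Ioc (-lam) lam
    · simp only [indicator_of_mem ht]
      rw [Circle.smul_def, Real.fourierChar_apply, smul_eq_mul]
      have : ((2 * π * -(t * (-(2 * π)⁻¹ * b)) : ℝ) : ℂ) * Complex.I = Complex.I * b * t := by
        rw [show 2 * π * -(t * (-(2 * π)⁻¹ * b)) = b * t by field_simp]
        push_cast; ring
      rw [this]; ring
    · simp only [indicator_of_notMem ht, smul_zero]

lemma fejK_mass : ∃ κ : ℝ, 0 < κ ∧ (∀ lam, 0 < lam → ∫ x, fejK lam x = κ) ∧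
    ∀ δ, 0 < δ → Tendsto (fun lam => ∫ x in (-δ)..δ, fejK lam x) atTop (𝓝 κ) := by
  have hform : ∀ lam x, fejK lam x = lam * (fun y => (Real.sinc y) ^ 2) (lam / 2 * x) := by
    intro lam x; simp only [fejK]; congr 3; ring
  refine ⟨2 * ∫ y, (Real.sinc y) ^ 2, ?_, ?_, ?_⟩
  · have : 0 < ∫ y, (Real.sinc y) ^ 2 := by
      rw [integral_pos_iff_support_of_nonneg (fun x => sq_nonneg _) sinc_sq_integrable]
      refine IsOpen.measure_pos _ ?_ ⟨0, by simp⟩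
      exact (Real.continuous_sinc.pow 2).isOpen_support
    linarith
  · intro lam hlam
    simp_rw [hform]
    rw [integral_const_mul, Measure.integral_comp_mul_left (fun y => (Real.sinc y) ^ 2), abs_of_pos (by positivity), smul_eq_mul]
    field_simp
  · intro δ hδ
    have h1 : ∀ᶠ lam : ℝ in atTop, 2 * ∫ y in (-(lam / 2 * δ))..(lam / 2 * δ), (Real.sinc y) ^ 2 =
        ∫ x in (-δ)..δ, fejK lam x := by
      filter_upwards [eventually_gt_atTop 0] with lam hlam
      simp_rw [hform]
      rw [intervalIntegral.integral_const_mul, intervalIntegral.integral_comp_mul_left (fun y => (Real.sinc y) ^ 2) (by positivity),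
        smul_eq_mul, mul_neg]
      field_simp
    refine Tendsto.congr' h1 (Tendsto.const_mul _ ?_)
    have ht : Tendsto (fun lam : ℝ => lam / 2 * δ) atTop atTop :=
      (tendsto_id.atTop_div_const (by norm_num)).atTop_mul_const hδ
    exact intervalIntegral_tendsto_integral sinc_sq_integrable (tendsto_neg_atTop_atBot.comp ht) ht

theorem wiener_ikehara (ψ : ℝ → ℝ) (hmono : Monotone ψ) (hnn : ∀ x, 0 ≤ ψ x) (η A : ℝ) (hη : 0 < η)
    (hint : ∀ σ, η < σ → IntegrableOn (fun x => ψ x * Real.exp (-σ * x)) (Ioi 0))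
    (G : ℂ → ℂ) (hG : ContinuousOn G {s | η ≤ s.re})
    (hF : ∀ s : ℂ, η < s.re → ∫ x in Ioi (0:ℝ), (ψ x : ℂ) * Complex.exp (-s * x) = A / (s - η) + G s) :
    Tendsto (fun x => ψ x * Real.exp (-η * x)) atTop (𝓝 A) := by
  obtain ⟨κ, hκ, hκ1, hκ2⟩ := fejK_mass
  have hS := fun lam (hlam : 0 < lam) => WI_smooth ψ hnn η A hint G hG hF lam hlam
  set B : ℝ → ℝ := fun x => ψ x * Real.exp (-η * x) with hB
  have hB0 : ∀ x, 0 ≤ B x := fun x => mul_nonneg (hnn x) (Real.exp_pos _).le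
  have hBm : ∀ x y, x ≤ y → B x ≤ B y * Real.exp (η * (y - x)) := by
    intro x y hxy
    have h1 : B y * Real.exp (η * (y - x)) = ψ y * Real.exp (-η * x) := by
      simp only [hB]
      rw [mul_assoc, ← Real.exp_add]; ring_nf
    rw [h1]
    exact mul_le_mul_of_nonneg_right (hmono hxy) (Real.exp_pos _).le
  have hKb : ∀ lam, 0 < lam → ∀ b, Integrable (fun x => fejK lam (b - x)) := fun lam hlam b =>
    (fejK_integrable hlam).comp_sub_left b
  have hc : ∀ lam, 0 < lam → ∀ δ, 0 < δ → ∀ b, ∫ x in Icc (b - δ) (b + δ), fejK lam (b - x) =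
      ∫ x in (-δ)..δ, fejK lam x := by
    intro lam hlam δ hδ b
    rw [integral_Icc_eq_integral_Ioc, ← intervalIntegral.integral_of_le (by linarith),
      intervalIntegral.integral_comp_sub_left]
    congr 1 <;> ring
  have hub : ∀ a, A < a → ∀ᶠ x in atTop, B x < a := by
    intro a ha
    have h1 : ∀ᶠ δ in 𝓝[>] (0:ℝ), A < a * Real.exp (-(2 * η * δ)) := by
      have : Tendsto (fun δ => a * Real.exp (-(2 * η * δ))) (𝓝 0) (𝓝 a) := by
        have : Continuous (fun δ => a * Real.exp (-(2 * η * δ))) := by fun_prop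
        simpa using this.tendsto 0
      exact (this.eventually (lt_mem_nhds ha)).filter_mono nhdsWithin_le_nhds
    obtain ⟨δ, hδA, hδ⟩ := (h1.and self_mem_nhdsWithin).exists
    have hδ : 0 < δ := hδ
    have h2 : ∀ᶠ lam in atTop, A * κ < a * Real.exp (-(2 * η * δ)) * ∫ x in (-δ)..δ, fejK lam x :=
      ((hκ2 δ hδ).const_mul _).eventually (lt_mem_nhds (by nlinarith))
    obtain ⟨lam, ⟨hl1, hl2⟩, hl0⟩ := ((h2.and ((hκ2 δ hδ).eventually (lt_mem_nhds hκ))).and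
      (eventually_gt_atTop 0)).exists
    have h3 := (hS lam hl0).2.eventually (gt_mem_nhds (by rw [hκ1 lam hl0]; exact hl1))
    have h4 : Tendsto (fun x : ℝ => x + δ) atTop atTop := tendsto_atTop_add_const_right _ _ tendsto_id
    filter_upwards [h4.eventually h3, eventually_gt_atTop 0] with x hx hx0
    set b := x + δ with hb
    have h5 : B x * Real.exp (-(2 * η * δ)) * ∫ x in (-δ)..δ, fejK lam x ≤
        ∫ x in Ioi (0:ℝ), ψ x * Real.exp (-η * x) * fejK lam (b - x) := by
      rw [← hc lam hl0 δ hδ b, ← integral_const_mul]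
      have hsub : Icc (b - δ) (b + δ) ⊆ Ioi 0 := fun y hy => by
        have := hy.1; simp only [mem_Ioi]; linarith
      refine le_trans (setIntegral_mono_on ((hKb lam hl0 b).const_mul _).integrableOn
        (((hS lam hl0).1 b).mono_set hsub) measurableSet_Icc ?_)
        (setIntegral_mono_set ((hS lam hl0).1 b) (Eventually.of_forall fun y =>
          mul_nonneg (hB0 y) (fejK_nonneg hl0 _)) hsub.eventuallyLE)
      intro y hy
      refine mul_le_mul_of_nonneg_right ?_ (fejK_nonneg hl0 _)
      have h6 := hBm x y (by have := hy.1; linarith)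
      have h7 : Real.exp (η * (y - x)) ≤ Real.exp (2 * η * δ) := by
        rw [Real.exp_le_exp]
        have := hy.2
        nlinarith
      calc B x * Real.exp (-(2 * η * δ)) ≤ (B y * Real.exp (2 * η * δ)) * Real.exp (-(2 * η * δ)) := by
            refine mul_le_mul_of_nonneg_right ?_ (Real.exp_pos _).le
            exact h6.trans (mul_le_mul_of_nonneg_left h7 (hB0 y))
        _ = B y := by rw [mul_assoc, ← Real.exp_add]; simp
    have h8 := h5.trans_lt hx
    have h9 := lt_of_mul_lt_mul_right h8 hl2.le
    exact lt_of_mul_lt_mul_right h9 (Real.exp_pos _).le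
  obtain ⟨M, hM0, hM⟩ : ∃ M, 0 ≤ M ∧ ∀ x, 0 ≤ x → B x ≤ M := by
    obtain ⟨X, hX⟩ := eventually_atTop.1 (hub (A + 1) (by linarith))
    refine ⟨max (A + 1) (ψ X), le_max_of_le_right (hnn X), fun x hx => ?_⟩
    rcases le_total X x with h | h
    · exact le_max_of_le_left (hX x h).le
    · refine le_max_of_le_right ?_
      have : Real.exp (-η * x) ≤ 1 := by rw [Real.exp_le_one_iff]; nlinarith
      calc B x ≤ ψ x * 1 := mul_le_mul_of_nonneg_left this (hnn x)
        _ ≤ ψ X := by rw [mul_one]; exact hmono h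
  have hlb : ∀ a, a < A → ∀ᶠ x in atTop, a < B x := by
    intro a ha
    have h1 : ∀ᶠ δ in 𝓝[>] (0:ℝ), a * Real.exp (2 * η * δ) < A := by
      have : Tendsto (fun δ => a * Real.exp (2 * η * δ)) (𝓝 0) (𝓝 a) := by
        have : Continuous (fun δ => a * Real.exp (2 * η * δ)) := by fun_prop
        simpa using this.tendsto 0
      exact (this.eventually (gt_mem_nhds ha)).filter_mono nhdsWithin_le_nhds
    obtain ⟨δ, hδA, hδ⟩ := (h1.and self_mem_nhdsWithin).exists
    have hδ : 0 < δ := hδ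
    have h2 : ∀ᶠ lam in atTop, a * Real.exp (2 * η * δ) * κ + M * (κ - ∫ x in (-δ)..δ, fejK lam x) < A * κ := by
      refine ((((hκ2 δ hδ).const_sub κ).const_mul M).const_add (a * Real.exp (2 * η * δ) * κ)).eventually
        (gt_mem_nhds ?_)
      simp only [sub_self, mul_zero, add_zero]
      nlinarith
    obtain ⟨lam, hl1, hl0⟩ := (h2.and (eventually_gt_atTop 0)).exists
    have h3 := (hS lam hl0).2.eventually (lt_mem_nhds (by rw [hκ1 lam hl0]; exact hl1))
    have h4 : Tendsto (fun x : ℝ => x - δ) atTop atTop := tendsto_atTop_add_const_right _ _ tendsto_id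
    filter_upwards [h4.eventually h3] with x hx
    set b := x - δ with hb
    have hK := hKb lam hl0 b
    have h5 : ∫ x in Ioi (0:ℝ), ψ x * Real.exp (-η * x) * fejK lam (b - x) ≤
        B x * Real.exp (2 * η * δ) * κ + M * (κ - ∫ x in (-δ)..δ, fejK lam x) := by
      have hg : Integrable (fun y => B x * Real.exp (2 * η * δ) * fejK lam (b - y) +
          M * (Icc (b - δ) (b + δ))ᶜ.indicator (fun y => fejK lam (b - y)) y) :=
        (hK.const_mul _).add ((hK.indicator measurableSet_Icc.compl).const_mul M)
      have hval : ∫ y, (B x * Real.exp (2 * η * δ) * fejK lam (b - y) +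
          M * (Icc (b - δ) (b + δ))ᶜ.indicator (fun y => fejK lam (b - y)) y) =
          B x * Real.exp (2 * η * δ) * κ + M * (κ - ∫ x in (-δ)..δ, fejK lam x) := by
        have e1 : ∫ y, fejK lam (b - y) = κ := by
          rw [integral_sub_left_eq_self (fejK lam) volume b]; exact hκ1 lam hl0
        rw [integral_add (hK.const_mul _) ((hK.indicator measurableSet_Icc.compl).const_mul M),
          integral_const_mul, integral_const_mul, integral_indicator measurableSet_Icc.compl, e1]
        have e2 := integral_add_compl (measurableSet_Icc (a := b - δ) (b := b + δ)) hK
        rw [e1, hc lam hl0 δ hδ b] at e2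
        rw [← e2]; ring
      rw [← hval]
      have hnng : ∀ y, 0 ≤ B x * Real.exp (2 * η * δ) * fejK lam (b - y) +
          M * (Icc (b - δ) (b + δ))ᶜ.indicator (fun y => fejK lam (b - y)) y := by
        intro y
        have := fejK_nonneg hl0 (b - y)
        have h7 : 0 ≤ (Icc (b - δ) (b + δ))ᶜ.indicator (fun y => fejK lam (b - y)) y :=
          indicator_nonneg (fun z _ => fejK_nonneg hl0 _) _
        have := hB0 x
        positivity
      refine le_trans (setIntegral_mono_on ((hS lam hl0).1 b) hg.integrableOn measurableSet_Ioi ?_)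
        (setIntegral_le_integral hg (Eventually.of_forall hnng))
      intro y hy
      have hy : 0 < y := hy
      have hk := fejK_nonneg hl0 (b - y)
      by_cases hyI : y ∈ Icc (b - δ) (b + δ)
      · rw [indicator_of_notMem (by simpa using hyI), mul_zero, add_zero]
        refine mul_le_mul_of_nonneg_right ?_ hk
        refine (hBm y x (by have := hyI.2; linarith)).trans (mul_le_mul_of_nonneg_left ?_ (hB0 x))
        rw [Real.exp_le_exp]
        have := hyI.1
        nlinarith
      · rw [indicator_of_mem (by simpa using hyI)]
        have h8 := mul_le_mul_of_nonneg_right (hM y hy.le) hk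
        have h9 : 0 ≤ B x * Real.exp (2 * η * δ) * fejK lam (b - y) :=
          mul_nonneg (mul_nonneg (hB0 x) (Real.exp_pos _).le) hk
        simp only [hB] at h8
        linarith
    have h8 : a * Real.exp (2 * η * δ) * κ < B x * Real.exp (2 * η * δ) * κ := by linarith
    have h9 := lt_of_mul_lt_mul_right h8 hκ.le
    exact lt_of_mul_lt_mul_right h9 (Real.exp_pos _).le
  exact tendsto_order.2 ⟨hlb, hub⟩

/-- Weighted counting function of the points `X p ≤ T` with weights `a p`. -/
noncomputable def cnt {ι : Type*} (X a : ι → ℝ) (T : ℝ) : ℝ := ∑' p, if X p ≤ T then a p else 0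

section
variable {ι : Type*} (X a : ι → ℝ)

lemma cnt_nonneg (ha : ∀ p, 0 ≤ a p) (T : ℝ) : 0 ≤ cnt X a T :=
  tsum_nonneg fun p => by split_ifs <;> simp [ha p]

lemma cnt_mono (ha : ∀ p, 0 ≤ a p) (hs : ∀ T, Summable fun p => if X p ≤ T then a p else 0) :
    Monotone (cnt X a) := by
  intro S T hST
  refine Summable.tsum_le_tsum (fun p => ?_) (hs S) (hs T)
  by_cases h : X p ≤ S
  · simp [h, h.trans hST]
  · simp only [h, if_false]; split_ifs <;> simp [ha p]

lemma cnt_term_le (ha : ∀ p, 0 ≤ a p) (σ T : ℝ) (hσ : 0 ≤ σ) (p : ι) :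
    (if X p ≤ T then a p else 0) ≤ a p * Real.exp (-σ * X p) * Real.exp (σ * T) := by
  split_ifs with h
  · rw [mul_assoc, ← Real.exp_add]
    refine le_mul_of_one_le_right (ha p) (Real.one_le_exp ?_)
    nlinarith
  · have := ha p; positivity

lemma cnt_summable (ha : ∀ p, 0 ≤ a p) (σ : ℝ) (hσ : 0 ≤ σ)
    (hs : Summable fun p => a p * Real.exp (-σ * X p)) (T : ℝ) :
    Summable fun p => if X p ≤ T then a p else 0 :=
  Summable.of_nonneg_of_le (fun p => by split_ifs <;> simp [ha p]) (cnt_term_le X a ha σ T hσ)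
    (hs.mul_right _)

end

lemma cnt_wiener {ι : Type*} [Countable ι] (X m : ι → ℝ) (hX : ∀ p, 0 < X p) (hm : ∀ p, 0 ≤ m p)
    (η : ℝ) (hη : 0 < η) (hs : ∀ σ, η < σ → Summable fun p => m p * Real.exp (-σ * X p))
    (G : ℂ → ℂ) (hG : ContinuousOn G {s | η ≤ s.re})
    (hD : ∀ s : ℂ, η < s.re → ∑' p, (m p : ℂ) * Complex.exp (-s * X p) = 1 / (s - η) + G s) :
    Tendsto (fun T => cnt X m T * Real.exp (-η * T)) atTop (𝓝 (1 / η)) := by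
  have hsum := cnt_summable X m hm (η + 1) (by linarith) (hs _ (by linarith))
  have hmono := cnt_mono X m hm hsum
  have hne : ∀ s : ℂ, η ≤ s.re → s ≠ 0 := fun s h h0 => by rw [h0] at h; simp at h; linarith
  refine wiener_ikehara (cnt X m) hmono (cnt_nonneg X m hm) η (1 / η) hη ?_
    (fun s => G s / s - 1 / (η * s)) ?_ ?_
  · intro σ hσ
    set σ' := (η + σ) / 2 with hσ'
    have h1 : η < σ' := by rw [hσ']; linarith
    have h2 : σ' < σ := by rw [hσ']; linarith
    have hb : IntegrableOn (fun x : ℝ => (∑' p, m p * Real.exp (-σ' * X p)) * Real.exp (-(σ - σ') * x)) (Ioi 0) :=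
      (integrableOn_exp_mul_Ioi (by linarith) 0).const_mul _
    refine Integrable.mono' hb ?_ (Eventually.of_forall fun x => ?_)
    · exact (hmono.measurable.mul (by fun_prop)).aestronglyMeasurable
    · rw [Real.norm_of_nonneg (mul_nonneg (cnt_nonneg X m hm x) (Real.exp_pos _).le)]
      have h3 : cnt X m x ≤ (∑' p, m p * Real.exp (-σ' * X p)) * Real.exp (σ' * x) := by
        rw [← tsum_mul_right]
        exact Summable.tsum_le_tsum (cnt_term_le X m hm σ' x (by linarith)) (hsum x)
          ((hs σ' h1).mul_right _)
      calc _ ≤ (∑' p, m p * Real.exp (-σ' * X p)) * Real.exp (σ' * x) * Real.exp (-σ * x) :=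
            mul_le_mul_of_nonneg_right h3 (Real.exp_pos _).le
        _ = _ := by rw [mul_assoc, ← Real.exp_add]; ring_nf
  · refine ContinuousOn.sub (hG.div continuousOn_id fun s hs => hne s hs) ?_
    refine continuousOn_const.div (continuousOn_const.mul continuousOn_id) fun s hs => ?_
    have : (η : ℂ) ≠ 0 := by exact_mod_cast hη.ne'
    exact mul_ne_zero this (hne s hs)
  · intro s hsre
    have hs0 := hne s hsre.le
    have hre : (-s).re < 0 := by simp; linarith
    have hind : ∀ p, ∀ x : ℝ, (((if X p ≤ x then m p else 0 : ℝ) : ℂ) * Complex.exp (-s * x)) =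
        (Ici (X p)).indicator (fun x : ℝ => (m p : ℂ) * Complex.exp (-s * x)) x := by
      intro p x
      by_cases h : X p ≤ x <;> simp [indicator, h]
    have hsub : ∀ p, Ici (X p) ∩ Ioi 0 = Ici (X p) := fun p =>
      inter_eq_left.2 fun x hx => (hX p).trans_le hx
    have hint : ∀ p, Integrable (fun x : ℝ => (((if X p ≤ x then m p else 0 : ℝ) : ℂ) * Complex.exp (-s * x)))
        (volume.restrict (Ioi 0)) := by
      intro p
      simp_rw [hind]
      refine Integrable.indicator ?_ measurableSet_Ici
      exact (integrableOn_exp_mul_complex_Ioi hre 0).const_mul _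
    have hval : ∀ p, ∫ x in Ioi (0:ℝ), (((if X p ≤ x then m p else 0 : ℝ) : ℂ) * Complex.exp (-s * x)) =
        (m p : ℂ) * Complex.exp (-s * X p) / s := by
      intro p
      simp_rw [hind]
      rw [integral_indicator measurableSet_Ici, Measure.restrict_restrict measurableSet_Ici, hsub,
        integral_const_mul, integral_Ici_eq_integral_Ioi, integral_exp_mul_complex_Ioi hre]
      field_simp
    have hnorm : ∀ p, ∫ x in Ioi (0:ℝ), ‖(((if X p ≤ x then m p else 0 : ℝ) : ℂ) * Complex.exp (-s * x))‖ =
        m p * Real.exp (-s.re * X p) / s.re := by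
      intro p
      have e : ∀ x : ℝ, ‖(((if X p ≤ x then m p else 0 : ℝ) : ℂ) * Complex.exp (-s * x))‖ =
        (Ici (X p)).indicator (fun x : ℝ => m p * Real.exp (-s.re * x)) x := by
        intro x
        rw [hind, norm_indicator_eq_indicator_norm]
        congr 1
        funext y
        rw [norm_mul, Complex.norm_exp, Complex.norm_real, Real.norm_of_nonneg (hm p)]
        simp
      simp_rw [e]
      rw [integral_indicator measurableSet_Ici, Measure.restrict_restrict measurableSet_Ici, hsub,
        integral_const_mul, integral_Ici_eq_integral_Ioi, integral_exp_mul_Ioi (by linarith)]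
      have : s.re ≠ 0 := by linarith
      field_simp
    have hH := hasSum_integral_of_summable_integral_norm hint (by
      simp_rw [hnorm]
      exact (hs _ hsre).div_const _)
    have e1 : ∫ x in Ioi (0:ℝ), (cnt X m x : ℂ) * Complex.exp (-s * x) =
        ∫ x in Ioi (0:ℝ), ∑' p, (((if X p ≤ x then m p else 0 : ℝ) : ℂ) * Complex.exp (-s * x)) := by
      refine integral_congr_ae (Eventually.of_forall fun x => ?_)
      simp only [cnt]
      rw [Complex.ofReal_tsum, tsum_mul_right]
    rw [e1, ← hH.tsum_eq]
    simp_rw [hval]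
    rw [tsum_div_const, hD s hsre]
    have h1 : (η : ℂ) ≠ 0 := by exact_mod_cast hη.ne'
    have h2 : s - η ≠ 0 := fun h => by
      have : s.re = η := by rw [sub_eq_zero.1 h]; simp
      linarith
    push_cast
    field_simp
    ring

lemma zeta_logDeriv {L : Type*} (l w : L → ℝ) (l₀ : ℝ) (hl₀ : 0 < l₀)
    (hl : ∀ γ, l₀ ≤ l γ) (hw : ∀ γ, 0 ≤ w γ) (η : ℝ)
    (F : ℂ → ℂ) (hF : ∀ s, F s = ∑' p : L × ℕ, (w p.1 : ℂ) ^ (p.2 + 1) *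
      Complex.exp (-((p.2 : ℂ) + 1) * s * (l p.1 : ℂ)) / ((p.2 : ℂ) + 1))
    (hconv : ∀ σ : ℝ, η < σ →
      Summable (fun p : L × ℕ =>
        w p.1 ^ (p.2 + 1) * Real.exp (-((p.2 : ℝ) + 1) * σ * l p.1) /
          ((p.2 : ℝ) + 1)))
    (U : Set ℂ) (hU : IsOpen U) (hUs : {s : ℂ | η ≤ s.re} ⊆ U)
    (g : ℂ → ℂ) (hg : AnalyticOnNhd ℂ g U) (hg0 : ∀ s ∈ U, g s ≠ 0)
    (hZ : ∀ s ∈ U, η < s.re → Complex.exp (F s) = g s / (s - (η : ℂ)))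
    (s : ℂ) (hs : η < s.re) :
    ∑' p : L × ℕ, ((l p.1 * w p.1 ^ (p.2 + 1) : ℝ) : ℂ) *
      Complex.exp (-s * ((((p.2 : ℝ) + 1) * l p.1 : ℝ) : ℂ)) = 1 / (s - η) + -(deriv g s / g s) := by
  set σ := (η + s.re) / 2 with hσ
  have h1 : η < σ := by rw [hσ]; linarith
  have h2 : σ < s.re := by rw [hσ]; linarith
  have hV : IsOpen {z : ℂ | σ < z.re} := isOpen_lt continuous_const Complex.continuous_re
  set f : L × ℕ → ℂ → ℂ := fun p s => (w p.1 : ℂ) ^ (p.2 + 1) *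
      Complex.exp (-((p.2 : ℂ) + 1) * s * (l p.1 : ℂ)) / ((p.2 : ℂ) + 1) with hf
  have hk : ∀ k : ℕ, ((k : ℂ) + 1) ≠ 0 := fun k => by exact_mod_cast Nat.succ_ne_zero k
  have hder : ∀ p z, HasDerivAt (f p) (-(((l p.1 * w p.1 ^ (p.2 + 1) : ℝ) : ℂ) *
      Complex.exp (-z * ((((p.2 : ℝ) + 1) * l p.1 : ℝ) : ℂ)))) z := by
    intro p z
    have h3 : HasDerivAt (fun s : ℂ => -((p.2 : ℂ) + 1) * s * (l p.1 : ℂ)) (-((p.2 : ℂ) + 1) * 1 * (l p.1 : ℂ)) z :=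
      ((hasDerivAt_id z).const_mul _).mul_const _
    have h4 := (h3.cexp.const_mul ((w p.1 : ℂ) ^ (p.2 + 1))).div_const ((p.2 : ℂ) + 1)
    refine h4.congr_deriv ?_
    have := hk p.2
    push_cast
    rw [show -z * (((p.2 : ℂ) + 1) * l p.1) = -((p.2 : ℂ) + 1) * z * (l p.1 : ℂ) by ring]
    field_simp
  have hbd : ∀ p, ∀ z ∈ {z : ℂ | σ < z.re}, ‖f p z‖ ≤ w p.1 ^ (p.2 + 1) * Real.exp (-((p.2 : ℝ) + 1) * σ * l p.1) /
          ((p.2 : ℝ) + 1) := by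
    intro p z hz
    have hz : σ < z.re := hz
    have e1 : ‖((p.2 : ℂ) + 1)‖ = (p.2 : ℝ) + 1 := by
      rw [show ((p.2 : ℂ) + 1) = (((p.2 : ℝ) + 1 : ℝ) : ℂ) by push_cast; rfl, Complex.norm_real,
        Real.norm_of_nonneg (by positivity)]
    have e2 : (-((p.2 : ℂ) + 1) * z * (l p.1 : ℂ)).re = -((p.2 : ℝ) + 1) * z.re * l p.1 := by
      rw [show -((p.2 : ℂ) + 1) * z * (l p.1 : ℂ) = ((-((p.2 : ℝ) + 1) * l p.1 : ℝ) : ℂ) * z by push_cast; ring,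
        Complex.re_ofReal_mul]
      ring
    simp only [hf]
    rw [norm_div, norm_mul, norm_pow, Complex.norm_real, Complex.norm_exp, e1, e2,
      Real.norm_of_nonneg (hw _)]
    have h5 := hw p.1
    have h6 : 0 < l p.1 := hl₀.trans_le (hl _)
    have h7 : -((p.2 : ℝ) + 1) * z.re * l p.1 ≤ -((p.2 : ℝ) + 1) * σ * l p.1 := by
      refine mul_le_mul_of_nonneg_right ?_ h6.le
      have : (0:ℝ) ≤ p.2 := Nat.cast_nonneg _
      nlinarith
    gcongr
  have hFf : F = fun z => ∑' p, f p z := funext hF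
  have hdiff : DifferentiableOn ℂ F {z : ℂ | σ < z.re} := by
    rw [hFf]
    exact Complex.differentiableOn_tsum_of_summable_norm (hconv σ h1)
      (fun p z _ => (hder p z).differentiableAt.differentiableWithinAt) hV hbd
  have hsumd := Complex.hasSum_deriv_of_summable_norm (hconv σ h1)
      (fun p z _ => (hder p z).differentiableAt.differentiableWithinAt) hV hbd (z := s) h2
  rw [← hFf] at hsumd
  have hda : HasDerivAt F (deriv F s) s := (hdiff.differentiableAt (hV.mem_nhds h2)).hasDerivAt
  have hsU : s ∈ U := hUs (show η ≤ s.re from hs.le)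
  have hsne : s - η ≠ 0 := fun h => by
      have : s.re = η := by rw [sub_eq_zero.1 h]; simp
      linarith
  have hgs := hg0 s hsU
  have hgd : HasDerivAt g (deriv g s) s := (hg s hsU).differentiableAt.hasDerivAt
  have hq := hgd.div ((hasDerivAt_id s).sub_const (η : ℂ)) hsne
  have heq : (fun z => Complex.exp (F z)) =ᶠ[𝓝 s] fun z => g z / (z - η) := by
    filter_upwards [hU.mem_nhds hsU, (isOpen_lt continuous_const Complex.continuous_re).mem_nhds hs] with z hz hz2
    exact hZ z hz hz2
  have h8 := (hda.cexp).unique (hq.congr_of_eventuallyEq heq)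
  rw [hZ s hsU hs] at h8
  have h9 : deriv F s = deriv g s / g s - 1 / (s - η) := by
    simp only [id] at h8
    field_simp at h8 ⊢
    linear_combination h8
  have h10 : HasSum (fun p : L × ℕ => -(((l p.1 * w p.1 ^ (p.2 + 1) : ℝ) : ℂ) *
      Complex.exp (-s * ((((p.2 : ℝ) + 1) * l p.1 : ℝ) : ℂ)))) (deriv F s) := by
    simpa only [(hder _ s).deriv] using hsumd
  have h11 := h10.neg.tsum_eq
  simp only [neg_neg] at h11
  rw [h11, h9]
  ring

lemma m_summable {L : Type*} (l w : L → ℝ) (l₀ : ℝ) (hl₀ : 0 < l₀)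
    (hl : ∀ γ, l₀ ≤ l γ) (hw : ∀ γ, 0 ≤ w γ) (η : ℝ)
    (hconv : ∀ σ : ℝ, η < σ →
      Summable (fun p : L × ℕ =>
        w p.1 ^ (p.2 + 1) * Real.exp (-((p.2 : ℝ) + 1) * σ * l p.1) /
          ((p.2 : ℝ) + 1))) (σ : ℝ) (hσ : η < σ) :
    Summable fun p : L × ℕ => (l p.1 * w p.1 ^ (p.2 + 1)) * Real.exp (-σ * (((p.2 : ℝ) + 1) * l p.1)) := by
  set σ' := (η + σ) / 2 with hσ'
  have h1 : η < σ' := by rw [hσ']; linarith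
  have h2 : 0 < σ - σ' := by rw [hσ']; linarith
  refine Summable.of_nonneg_of_le (fun p => ?_) (fun p => ?_) ((hconv σ' h1).mul_left (1 / (σ - σ')))
  · have := hw p.1
    have : 0 < l p.1 := hl₀.trans_le (hl _)
    positivity
  · have h3 := hw p.1
    have h4 : 0 < l p.1 := hl₀.trans_le (hl _)
    set x := ((p.2 : ℝ) + 1) * l p.1 with hx
    have hk : (0:ℝ) < (p.2 : ℝ) + 1 := by positivity
    have hlx : l p.1 = x / ((p.2 : ℝ) + 1) := by rw [hx]; field_simp
    have h5 : x * Real.exp (-σ * x) ≤ 1 / (σ - σ') * Real.exp (-σ' * x) := by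
      have h6 : (σ - σ') * x ≤ Real.exp ((σ - σ') * x) := by
        have := Real.add_one_le_exp ((σ - σ') * x); linarith
      have h7 : Real.exp (-σ' * x) = Real.exp ((σ - σ') * x) * Real.exp (-σ * x) := by
        rw [← Real.exp_add]; ring_nf
      rw [h7, ← mul_assoc (1 / (σ - σ'))]
      refine mul_le_mul_of_nonneg_right ?_ (Real.exp_pos _).le
      rw [one_div, ← div_eq_inv_mul, le_div_iff₀ h2]
      linarith
    calc (l p.1 * w p.1 ^ (p.2 + 1)) * Real.exp (-σ * x) =
          w p.1 ^ (p.2 + 1) / ((p.2 : ℝ) + 1) * (x * Real.exp (-σ * x)) := by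
          rw [hx]; field_simp
      _ ≤ w p.1 ^ (p.2 + 1) / ((p.2 : ℝ) + 1) * (1 / (σ - σ') * Real.exp (-σ' * x)) := by gcongr
      _ = _ := by
          rw [hx, show -((p.2 : ℝ) + 1) * σ' * l p.1 = -σ' * (((p.2 : ℝ) + 1) * l p.1) by ring]
          ring

lemma T_exp (c : ℝ) (hc : 0 < c) : Tendsto (fun T : ℝ => T * Real.exp (-c * T)) atTop (𝓝 0) := by
  simpa using tendsto_rpow_mul_exp_neg_mul_atTop_nhds_zero 1 c hc

lemma cnt_partial {ι : Type*} (X m : ι → ℝ) (l₀ : ℝ) (hl₀ : 0 < l₀) (hX : ∀ p, l₀ ≤ X p)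
    (hm : ∀ p, 0 ≤ m p) (hs : ∀ T, Summable fun p => if X p ≤ T then m p else 0)
    (η : ℝ) (hη : 0 < η)
    (hψ : Tendsto (fun T => cnt X m T * Real.exp (-η * T)) atTop (𝓝 (1 / η))) :
    (∀ T, Summable fun p => if X p ≤ T then m p / X p else 0) ∧
    Tendsto (fun T => cnt X (fun p => m p / X p) T * (η * T * Real.exp (-η * T))) atTop (𝓝 1) := by
  have hXpos : ∀ p, 0 < X p := fun p => hl₀.trans_le (hX p)
  have hs' : ∀ T, Summable fun p => if X p ≤ T then m p / X p else 0 := by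
    intro T
    refine Summable.of_nonneg_of_le (fun p => ?_) (fun p => ?_) ((hs T).mul_left (1 / l₀))
    · have := hm p; have := hXpos p; split_ifs <;> positivity
    · split_ifs
      · rw [div_eq_mul_inv, mul_comm, one_div]
        exact mul_le_mul_of_nonneg_right (inv_anti₀ hl₀ (hX p)) (hm p)
      · simp
  refine ⟨hs', ?_⟩
  have hψ1 : Tendsto (fun T => η * (cnt X m T * Real.exp (-η * T))) atTop (𝓝 1) := by
    have := hψ.const_mul η
    rwa [mul_one_div_cancel hη.ne'] at this
  refine tendsto_order.2 ⟨fun a ha => ?_, fun a ha => ?_⟩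
  · filter_upwards [hψ1.eventually (lt_mem_nhds ha), eventually_gt_atTop 0] with T hT hT0
    refine hT.trans_le ?_
    have h1 : cnt X m T ≤ cnt X (fun p => m p / X p) T * T := by
      unfold cnt
      rw [← tsum_mul_right]
      refine Summable.tsum_le_tsum (fun p => ?_) (hs T) ((hs' T).mul_right T)
      split_ifs with h
      · rw [div_mul_eq_mul_div, le_div_iff₀ (hXpos p)]
        exact mul_le_mul_of_nonneg_left h (hm p)
      · simp
    have := mul_le_mul_of_nonneg_right h1 (show 0 ≤ η * Real.exp (-η * T) by positivity)
    linarith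
  · have h1 : ∀ᶠ θ : ℝ in 𝓝[<] 1, θ⁻¹ < a := by
      have : Tendsto (fun θ : ℝ => θ⁻¹) (𝓝 1) (𝓝 1⁻¹) := tendsto_inv₀ one_ne_zero
      rw [inv_one] at this
      exact (this.eventually (gt_mem_nhds ha)).filter_mono nhdsWithin_le_nhds
    have h2 : ∀ᶠ θ : ℝ in 𝓝[<] 1, 0 < θ :=
      (lt_mem_nhds (zero_lt_one)).filter_mono nhdsWithin_le_nhds
    obtain ⟨θ, ⟨hθa, hθ0⟩, hθ1⟩ := ((h1.and h2).and self_mem_nhdsWithin).exists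
    have hθ1 : θ < 1 := hθ1
    have hθT : Tendsto (fun T : ℝ => θ * T) atTop atTop := tendsto_id.const_mul_atTop hθ0
    have h3 : Tendsto (fun T => (cnt X m (θ * T) * Real.exp (-η * (θ * T))) *
        (T * Real.exp (-(η * (1 - θ)) * T)) * (η / l₀) + η * (cnt X m T * Real.exp (-η * T)) * θ⁻¹)
        atTop (𝓝 (1 / η * 0 * (η / l₀) + 1 * θ⁻¹)) :=
      (((hψ.comp hθT).mul (T_exp _ (mul_pos hη (by linarith)))).mul_const _).add (hψ1.mul_const _)
    rw [mul_zero, zero_mul, zero_add, one_mul] at h3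
    filter_upwards [h3.eventually (gt_mem_nhds hθa), eventually_gt_atTop 0] with T hT hT0
    refine lt_of_le_of_lt ?_ hT
    have h4 : cnt X (fun p => m p / X p) T ≤ cnt X m (θ * T) * (1 / l₀) + cnt X m T * (1 / (θ * T)) := by
      unfold cnt
      rw [← tsum_mul_right, ← tsum_mul_right,
        ← ((hs (θ * T)).mul_right _).tsum_add ((hs T).mul_right _)]
      refine Summable.tsum_le_tsum (fun p => ?_) (hs' T) (((hs (θ * T)).mul_right _).add ((hs T).mul_right _))
      have hmp := hm p
      have hXp := hXpos p
      by_cases h : X p ≤ T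
      · rw [if_pos h, if_pos h]
        by_cases h' : X p ≤ θ * T
        · rw [if_pos h']
          have e1 : m p / X p ≤ m p * (1 / l₀) := by
            rw [div_eq_mul_one_div]
            exact mul_le_mul_of_nonneg_left (one_div_le_one_div_of_le hl₀ (hX p)) hmp
          have : 0 ≤ m p * (1 / (θ * T)) := by positivity
          linarith
        · rw [if_neg h', zero_mul, zero_add]
          show m p / X p ≤ m p * (1 / (θ * T))
          rw [div_eq_mul_one_div (m p)]
          exact mul_le_mul_of_nonneg_left (one_div_le_one_div_of_le (by positivity) (not_le.1 h').le) hmp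
      · rw [if_neg h, if_neg h, zero_mul, add_zero]
        split_ifs <;> positivity
    have h5 := mul_le_mul_of_nonneg_right h4 (show 0 ≤ η * T * Real.exp (-η * T) by positivity)
    refine h5.trans (le_of_eq ?_)
    have e : Real.exp (-η * T) = Real.exp (-η * (θ * T)) * Real.exp (-(η * (1 - θ)) * T) := by
      rw [← Real.exp_add]; ring_nf
    rw [add_mul]
    congr 1
    · rw [e]; field_simp
    · field_simp

lemma cnt_jump {ι : Type*} (X m : ι → ℝ)
    (hm : ∀ p, 0 ≤ m p) (hs : ∀ T, Summable fun p => if X p ≤ T then m p else 0)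
    (η : ℝ) (hη : 0 < η)
    (hψ : Tendsto (fun T => cnt X m T * Real.exp (-η * T)) atTop (𝓝 (1 / η))) (ε : ℝ) (hε : 0 < ε) :
    ∃ M, ∀ p, M ≤ X p → m p ≤ ε * Real.exp (η * X p) := by
  have h1 : ∀ᶠ h : ℝ in 𝓝[>] 0, 1 / η - 1 / η * Real.exp (-η * h) < ε := by
    have hc : Continuous (fun h : ℝ => 1 / η - 1 / η * Real.exp (-η * h)) := by fun_prop
    have : Tendsto (fun h : ℝ => 1 / η - 1 / η * Real.exp (-η * h)) (𝓝 0) (𝓝 0) := by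
      simpa using hc.tendsto 0
    exact (this.eventually (gt_mem_nhds hε)).filter_mono nhdsWithin_le_nhds
  obtain ⟨h, hh, hpos⟩ := (h1.and self_mem_nhdsWithin).exists
  have hpos : 0 < h := hpos
  have hsh : Tendsto (fun T : ℝ => T - h) atTop atTop := tendsto_atTop_add_const_right _ _ tendsto_id
  have h2 := hψ.sub ((hψ.comp hsh).mul_const (Real.exp (-η * h)))
  obtain ⟨M, hM⟩ := eventually_atTop.1 (h2.eventually (gt_mem_nhds hh))
  refine ⟨M, fun p hp => ?_⟩
  have h3 := hM (X p) hp
  have h4 : cnt X m (X p - h) + m p ≤ cnt X m (X p) := by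
    classical
    have hsingle : HasSum (fun q => if q = p then m p else 0) (m p) := hasSum_ite_eq p (m p)
    have := ((hs (X p - h)).hasSum).add hsingle
    refine hasSum_le (fun q => ?_) this (hs (X p)).hasSum
    by_cases hq : q = p
    · subst hq
      simp [not_le.2 hpos]
    · simp only [hq, if_false, add_zero]
      by_cases hq1 : X q ≤ X p - h
      · rw [if_pos hq1, if_pos (by linarith)]
      · rw [if_neg hq1]; have := hm q; split_ifs <;> simp [this]
  simp only [Function.comp] at h3
  rw [mul_assoc (cnt X m (X p - h)), ← Real.exp_add,
    show -η * (X p - h) + -η * h = -η * X p by ring, ← sub_mul] at h3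
  have h5 : m p * Real.exp (-η * X p) ≤ ε :=
    (mul_le_mul_of_nonneg_right (by linarith) (Real.exp_pos _).le).trans h3.le
  have h6 := mul_le_mul_of_nonneg_right h5 (Real.exp_pos (η * X p)).le
  rw [mul_assoc, ← Real.exp_add] at h6
  simpa using h6

lemma iter_aux (k : ℕ) (T c C η S : ℝ) (hT : 0 < T) (hc : 0 ≤ c)
    (hS : S ≤ C * Real.exp (η * (T / ((k : ℝ) + 1))) / (T / ((k : ℝ) + 1))) :
    S * (c ^ k * Real.exp (η * k * (T / ((k : ℝ) + 1)))) * (T * Real.exp (-η * T)) ≤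
      C * ((k : ℝ) + 1) * c ^ k := by
  have hk : (0:ℝ) < (k : ℝ) + 1 := by positivity
  obtain ⟨y, hy⟩ : ∃ y, y = T / ((k : ℝ) + 1) := ⟨_, rfl⟩
  have hTy : T = ((k : ℝ) + 1) * y := by rw [hy]; field_simp
  have hy0 : 0 < y := by rw [hy]; positivity
  rw [← hy] at hS ⊢
  have h1 := mul_le_mul_of_nonneg_right hS
    (show 0 ≤ c ^ k * Real.exp (η * k * y) * (T * Real.exp (-η * T)) by positivity)
  rw [mul_assoc]
  refine h1.trans (le_of_eq ?_)
  have e : Real.exp (η * y) * Real.exp (η * k * y) * Real.exp (-η * T) = 1 := by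
    rw [← Real.exp_add, ← Real.exp_add, hTy, Real.exp_eq_one_iff]
    ring
  have e2 : T / y = (k : ℝ) + 1 := by rw [hTy]; field_simp
  rw [← e2]
  linear_combination (C * (T / y) * c ^ k) * e

set_option maxHeartbeats 1000000 in
lemma iterates_negligible {L : Type*} (l w : L → ℝ) (l₀ : ℝ) (hl₀ : 0 < l₀)
    (hl : ∀ γ, l₀ ≤ l γ) (hw : ∀ γ, 0 ≤ w γ) (η : ℝ) (hη : 0 < η)
    (hN : ∀ T, Summable fun p : L × ℕ => if ((p.2 : ℝ) + 1) * l p.1 ≤ T then w p.1 ^ (p.2 + 1) else 0)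
    (q : ℝ) (hq0 : 0 ≤ q) (hq1 : q < 1) (hq : ∀ γ, w γ ≤ q * Real.exp (η * l γ))
    (hsmall : ∀ ε > 0, ∃ M, ∀ γ, M ≤ l γ → w γ ≤ ε * Real.exp (η * l γ))
    (C : ℝ) (hC0 : 0 ≤ C)
    (hC : ∀ T, 0 < T → (∑' γ, if l γ ≤ T then w γ else 0) ≤ C * Real.exp (η * T) / T) :
    Tendsto (fun T => (∑' p : L × ℕ, if ((p.2 : ℝ) + 1) * l p.1 ≤ T ∧ p.2 ≠ 0 then w p.1 ^ (p.2 + 1) else 0) *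
      (T * Real.exp (-η * T))) atTop (𝓝 0) := by
  set β : ℕ → ℝ → ℝ := fun k T => ∑' γ, if ((k : ℝ) + 1) * l γ ≤ T then w γ ^ (k + 1) else 0 with hβ
  have hβs : ∀ (k : ℕ) (T : ℝ), Summable fun γ => if ((k : ℝ) + 1) * l γ ≤ T then w γ ^ (k + 1) else 0 := by
    intro k T
    exact (hN T).comp_injective (i := fun γ => (γ, k)) (fun a b h => by simpa using h)
  have hP1s : ∀ T, Summable fun γ => if l γ ≤ T then w γ else 0 := by
    intro T; simpa using hβs 0 T
  have hβ0 : ∀ k T, 0 ≤ β k T := fun k T => tsum_nonneg fun γ => by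
    have := hw γ; split_ifs <;> positivity
  have hR : ∀ T, (∑' p : L × ℕ, if ((p.2 : ℝ) + 1) * l p.1 ≤ T ∧ p.2 ≠ 0 then w p.1 ^ (p.2 + 1) else 0) =
      ∑' k : ℕ, if k ≠ 0 then β k T else 0 := by
    intro T
    have hsR : Summable fun p : L × ℕ => if ((p.2 : ℝ) + 1) * l p.1 ≤ T ∧ p.2 ≠ 0 then w p.1 ^ (p.2 + 1) else 0 := by
      refine Summable.of_nonneg_of_le (fun p => ?_) (fun p => ?_) (hN T)
      · have := hw p.1; split_ifs <;> positivity
      · have := hw p.1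
        by_cases h : ((p.2 : ℝ) + 1) * l p.1 ≤ T
        · simp only [h, true_and, if_true]; split_ifs
          · exact le_rfl
          · positivity
        · simp [h]
    rw [← (Equiv.prodComm ℕ L).tsum_eq, Summable.tsum_prod (f := fun c : ℕ × L => if (((Equiv.prodComm ℕ L c).2 : ℝ) + 1) * l (Equiv.prodComm ℕ L c).1 ≤ T ∧
        (Equiv.prodComm ℕ L c).2 ≠ 0 then w (Equiv.prodComm ℕ L c).1 ^ ((Equiv.prodComm ℕ L c).2 + 1) else 0)
        ((Equiv.prodComm ℕ L).summable_iff.2 hsR)]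
    refine tsum_congr fun k => ?_
    by_cases hk : k = 0
    · simp [hk]
    · simp [hk, hβ]
  simp_rw [hR, ← tsum_mul_right]
  have hterm : ∀ (k : ℕ) (T c : ℝ) (γ : L), 0 ≤ c → w γ ≤ c * Real.exp (η * l γ) →
      (if ((k : ℝ) + 1) * l γ ≤ T then w γ ^ (k + 1) else 0) ≤
      (if l γ ≤ T / ((k : ℝ) + 1) then w γ else 0) * (c ^ k * Real.exp (η * k * (T / ((k : ℝ) + 1)))) := by
    intro k T c γ hc hwc
    have hk : (0:ℝ) < (k : ℝ) + 1 := by positivity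
    have hiff : l γ ≤ T / ((k : ℝ) + 1) ↔ ((k : ℝ) + 1) * l γ ≤ T := by
      rw [le_div_iff₀ hk, mul_comm]
    by_cases h : ((k : ℝ) + 1) * l γ ≤ T
    · rw [if_pos h, if_pos (hiff.2 h), pow_succ']
      refine mul_le_mul_of_nonneg_left ?_ (hw γ)
      calc w γ ^ k ≤ (c * Real.exp (η * l γ)) ^ k := pow_le_pow_left₀ (hw γ) hwc k
        _ = c ^ k * Real.exp (η * k * l γ) := by
            rw [mul_pow, ← Real.exp_nat_mul]; ring_nf
        _ ≤ _ := by
            have := hiff.2 h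
            gcongr
    · rw [if_neg h, if_neg (fun h' => h (hiff.1 h')), zero_mul]
  have hP : ∀ (k : ℕ) (T c : ℝ), 0 < T → 0 ≤ c →
      (∑' γ, (if l γ ≤ T / ((k : ℝ) + 1) then w γ else 0) * (c ^ k * Real.exp (η * k * (T / ((k : ℝ) + 1))))) *
        (T * Real.exp (-η * T)) ≤ C * ((k : ℝ) + 1) * c ^ k := by
    intro k T c hT hc
    rw [tsum_mul_right]
    exact iter_aux k T c C η _ hT hc (hC (T / ((k : ℝ) + 1)) (by positivity))
  have hlimk : ∀ k : ℕ, k ≠ 0 → Tendsto (fun T => β k T * (T * Real.exp (-η * T))) atTop (𝓝 0) := by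
    intro k hk
    have hk1 : (0:ℝ) < (k : ℝ) + 1 := by positivity
    refine tendsto_order.2 ⟨fun a ha => ?_, fun a ha => ?_⟩
    · filter_upwards [eventually_gt_atTop 0] with T hT
      refine ha.trans_le (mul_nonneg (hβ0 k T) (by positivity))
    · set ε := min 1 (a / (2 * (C * ((k : ℝ) + 1) + 1))) with hε
      have hden : 0 < 2 * (C * ((k : ℝ) + 1) + 1) := by positivity
      have hε0 : 0 < ε := lt_min one_pos (by positivity)
      have hε1 : ε ≤ 1 := min_le_left _ _
      have hε2 : ε * (2 * (C * ((k : ℝ) + 1) + 1)) ≤ a := by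
        rw [← le_div_iff₀ hden]; exact min_le_right _ _
      obtain ⟨M, hM⟩ := hsmall ε hε0
      have h1 : Tendsto (fun T => β k (((k : ℝ) + 1) * M) * (T * Real.exp (-η * T))) atTop (𝓝 0) := by
        simpa using (T_exp η hη).const_mul (β k (((k : ℝ) + 1) * M))
      filter_upwards [h1.eventually (gt_mem_nhds (half_pos ha)), eventually_gt_atTop 0] with T hT hT0
      have hsm := (hP1s (T / ((k : ℝ) + 1))).mul_right (ε ^ k * Real.exp (η * k * (T / ((k : ℝ) + 1))))
      have h2 : β k T ≤ β k (((k : ℝ) + 1) * M) +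
          ∑' γ, (if l γ ≤ T / ((k : ℝ) + 1) then w γ else 0) * (ε ^ k * Real.exp (η * k * (T / ((k : ℝ) + 1)))) := by
        rw [hβ]
        simp only
        rw [← (hβs k (((k : ℝ) + 1) * M)).tsum_add hsm]
        refine Summable.tsum_le_tsum (fun γ => ?_) (hβs k T) ((hβs k (((k : ℝ) + 1) * M)).add hsm)
        have hwγ := hw γ
        rcases le_total M (l γ) with h | h
        · have := hterm k T ε γ hε0.le (hM γ h)
          have h0 : 0 ≤ (if ((k : ℝ) + 1) * l γ ≤ ((k : ℝ) + 1) * M then w γ ^ (k + 1) else 0) := by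
            split_ifs <;> positivity
          linarith
        · have h0 : 0 ≤ (if l γ ≤ T / ((k : ℝ) + 1) then w γ else 0) *
              (ε ^ k * Real.exp (η * k * (T / ((k : ℝ) + 1)))) := by
            split_ifs <;> positivity
          rw [if_pos (mul_le_mul_of_nonneg_left h hk1.le)]
          have : (if ((k : ℝ) + 1) * l γ ≤ T then w γ ^ (k + 1) else 0) ≤ w γ ^ (k + 1) := by
            split_ifs
            · exact le_rfl
            · positivity
          linarith
      have h3 := mul_le_mul_of_nonneg_right h2 (show 0 ≤ T * Real.exp (-η * T) by positivity)
      rw [add_mul] at h3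
      have h4 := hP k T ε hT0 hε0.le
      have h5 : ε ^ k ≤ ε := pow_le_of_le_one hε0.le hε1 hk
      have h6 : C * ((k : ℝ) + 1) * ε ^ k ≤ C * ((k : ℝ) + 1) * ε :=
        mul_le_mul_of_nonneg_left h5 (by positivity)
      nlinarith
  have hbsum : Summable fun k : ℕ => C * ((k : ℝ) + 1) * q ^ k := by
    have h1 := summable_pow_mul_geometric_of_norm_lt_one 1 (r := q) (by rwa [Real.norm_of_nonneg hq0])
    have h2 := summable_geometric_of_lt_one hq0 hq1
    refine ((h1.add h2).mul_left C).congr fun k => ?_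
    simp; ring
  have := tendsto_tsum_of_dominated_convergence (𝓕 := atTop)
    (f := fun (T : ℝ) (k : ℕ) => (if k ≠ 0 then β k T else 0) * (T * Real.exp (-η * T)))
    (g := fun _ => (0:ℝ)) hbsum ?_ ?_
  · simpa using this
  · intro k
    by_cases hk : k = 0
    · simp [hk]
    · simpa [hk] using hlimk k hk
  · filter_upwards [eventually_gt_atTop 0] with T hT k
    by_cases hk : k = 0
    · simp [hk, hC0]
    · simp only [ne_eq, hk, not_false_eq_true, if_true]
      rw [Real.norm_of_nonneg (mul_nonneg (hβ0 k T) (by positivity))]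
      refine le_trans ?_ (hP k T q hT hq0)
      refine mul_le_mul_of_nonneg_right ?_ (by positivity)
      exact Summable.tsum_le_tsum (fun γ => hterm k T q γ hq0 (hq γ)) (hβs k T)
        ((hP1s _).mul_right _)

lemma cnt_perturb {ι : Type*} (X n n' : ι → ℝ) (hX : ∀ p, 0 ≤ X p) (hn : ∀ p, 0 ≤ n p)
    (hs : ∀ T, Summable fun p => if X p ≤ T then n p else 0) (η : ℝ) (hη : 0 < η)
    (hN : Tendsto (fun T => cnt X n T * (η * T * Real.exp (-η * T))) atTop (𝓝 1))
    (C ε : ℝ) (hC : 0 < C) (hε : 0 < ε) 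
    (hd : ∀ p, |n' p - n p| ≤ C * (n p * Real.exp (-ε * X p))) :
    Tendsto (fun T => cnt X n' T * (η * T * Real.exp (-η * T))) atTop (𝓝 1) := by
  have hlim : Tendsto (fun T => C * ((cnt X n (T / 2) * (η * (T / 2) * Real.exp (-η * (T / 2)))) *
      (2 * Real.exp (-(η / 2) * T)) + Real.exp (-(ε / 2) * T) * (cnt X n T * (η * T * Real.exp (-η * T)))))
      atTop (𝓝 (C * (1 * (2 * 0) + 0 * 1))) := by
    have hexp : ∀ c : ℝ, 0 < c → Tendsto (fun T : ℝ => Real.exp (-c * T)) atTop (𝓝 0) := fun c hc =>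
      Real.tendsto_exp_atBot.comp (tendsto_id.const_mul_atTop_of_neg (by linarith))
    have hhalf : Tendsto (fun T : ℝ => T / 2) atTop atTop := tendsto_id.atTop_div_const (by norm_num)
    exact (((hN.comp hhalf).mul ((hexp (η / 2) (by linarith)).const_mul 2)).add
      ((hexp (ε / 2) (by linarith)).mul hN)).const_mul C
  rw [show C * (1 * (2 * 0) + 0 * 1) = (0:ℝ) by ring] at hlim
  have hE : ∀ T, 0 < T → |cnt X n' T - cnt X n T| ≤ C * (cnt X n (T / 2) + Real.exp (-(ε / 2) * T) * cnt X n T) := by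
    intro T hT
    have hsd : Summable fun p => C * ((if X p ≤ T / 2 then n p else 0) +
        Real.exp (-(ε / 2) * T) * (if X p ≤ T then n p else 0)) :=
      ((hs (T / 2)).add ((hs T).mul_left _)).mul_left C
    have hbd : ∀ p, ‖(if X p ≤ T then n' p - n p else 0)‖ ≤ C * ((if X p ≤ T / 2 then n p else 0) +
        Real.exp (-(ε / 2) * T) * (if X p ≤ T then n p else 0)) := by
      intro p
      have hnp := hn p
      by_cases h : X p ≤ T
      · rw [if_pos h, if_pos h, Real.norm_eq_abs]
        refine (hd p).trans (mul_le_mul_of_nonneg_left ?_ hC.le)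
        by_cases h' : X p ≤ T / 2
        · rw [if_pos h']
          have hXp := hX p
          have : Real.exp (-ε * X p) ≤ 1 := by rw [Real.exp_le_one_iff]; nlinarith
          have h2 : 0 ≤ Real.exp (-(ε / 2) * T) * n p := by positivity
          nlinarith
        · rw [if_neg h', zero_add, mul_comm]
          refine mul_le_mul_of_nonneg_right ?_ hnp
          rw [Real.exp_le_exp]
          nlinarith [not_le.1 h']
      · rw [if_neg h, if_neg h, norm_zero]
        split_ifs <;> positivity
    have hsub : Summable fun p => if X p ≤ T then n' p - n p else 0 := Summable.of_norm_bounded hsd hbd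
    have e : cnt X n' T - cnt X n T = ∑' p, if X p ≤ T then n' p - n p else 0 := by
      have : cnt X n' T = cnt X n T + ∑' p, if X p ≤ T then n' p - n p else 0 := by
        unfold cnt
        rw [← (hs T).tsum_add hsub]
        refine tsum_congr fun p => ?_
        split_ifs <;> ring
      rw [this]; ring
    rw [e, ← Real.norm_eq_abs]
    refine (tsum_of_norm_bounded hsd.hasSum hbd).trans (le_of_eq ?_)
    rw [tsum_mul_left, (hs (T / 2)).tsum_add ((hs T).mul_left _), tsum_mul_left]
    rfl
  have hdiff : Tendsto (fun T => (cnt X n' T - cnt X n T) * (η * T * Real.exp (-η * T))) atTop (𝓝 0) := by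
    refine squeeze_zero_norm' ?_ hlim
    filter_upwards [eventually_gt_atTop 0] with T hT
    have hp : 0 ≤ η * T * Real.exp (-η * T) := by positivity
    rw [norm_mul, Real.norm_of_nonneg hp, Real.norm_eq_abs]
    refine (mul_le_mul_of_nonneg_right (hE T hT) hp).trans (le_of_eq ?_)
    have e : Real.exp (-η * T) = Real.exp (-η * (T / 2)) * Real.exp (-(η / 2) * T) := by
      rw [← Real.exp_add]; ring_nf
    rw [e]; ring
  have := hN.add hdiff
  rw [add_zero] at this
  refine this.congr fun T => ?_
  ring

/-- The main counting asymptotics, in terms of `cnt`. -/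
lemma count_main {L : Type*} [Countable L] (l : L → ℝ) (l₀ : ℝ) (hl₀ : 0 < l₀)
    (hl : ∀ γ, l₀ ≤ l γ) (w : L → ℝ) (hw : ∀ γ, 0 ≤ w γ)
    (η : ℝ) (hη : 0 < η)
    (hconv : ∀ σ : ℝ, η < σ →
      Summable (fun p : L × ℕ =>
        w p.1 ^ (p.2 + 1) * Real.exp (-((p.2 : ℝ) + 1) * σ * l p.1) /
          ((p.2 : ℝ) + 1)))
    (F : ℂ → ℂ) (hF : ∀ s, F s = ∑' p : L × ℕ, (w p.1 : ℂ) ^ (p.2 + 1) *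
      Complex.exp (-((p.2 : ℂ) + 1) * s * (l p.1 : ℂ)) / ((p.2 : ℂ) + 1))
    (hext : ∃ U : Set ℂ, IsOpen U ∧ {s : ℂ | η ≤ s.re} ⊆ U ∧
      ∃ g : ℂ → ℂ, AnalyticOnNhd ℂ g U ∧ (∀ s ∈ U, g s ≠ 0) ∧
        ∀ s ∈ U, η < s.re → Complex.exp (F s) = g s / (s - (η : ℂ))) :
    (∀ T, Summable fun p : L × ℕ => if ((p.2 : ℝ) + 1) * l p.1 ≤ T then w p.1 ^ (p.2 + 1) else 0) ∧
    Tendsto (fun T => cnt (fun p : L × ℕ => ((p.2 : ℝ) + 1) * l p.1) (fun p => w p.1 ^ (p.2 + 1)) T *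
      (η * T * Real.exp (-η * T))) atTop (𝓝 1) := by
  obtain ⟨U, hU, hUs, g, hg, hg0, hZ⟩ := hext
  have hlpos : ∀ γ, 0 < l γ := fun γ => hl₀.trans_le (hl γ)
  set X : L × ℕ → ℝ := fun p => ((p.2 : ℝ) + 1) * l p.1 with hX
  set m : L × ℕ → ℝ := fun p => l p.1 * w p.1 ^ (p.2 + 1) with hm
  set n : L × ℕ → ℝ := fun p => w p.1 ^ (p.2 + 1) with hn
  have hn0 : ∀ p, 0 ≤ n p := fun p => pow_nonneg (hw _) _
  have hm0 : ∀ p, 0 ≤ m p := fun p => mul_nonneg (hlpos _).le (hn0 p)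
  have hXl : ∀ p, l₀ ≤ X p := fun p => by
    have h1 := hl p.1
    have h2 : (0:ℝ) ≤ p.2 := Nat.cast_nonneg _
    simp only [hX]; nlinarith
  have hms := m_summable l w l₀ hl₀ hl hw η hconv
  have hG : ContinuousOn (fun s => -(deriv g s / g s)) {s : ℂ | η ≤ s.re} := by
    refine ContinuousOn.mono ?_ hUs
    exact (hg.deriv.continuousOn.div hg.continuousOn hg0).neg
  have hψ := cnt_wiener X m (fun p => hl₀.trans_le (hXl p)) hm0 η hη hms _ hG
    (fun s hs => zeta_logDeriv l w l₀ hl₀ hl hw η F hF hconv U hU hUs g hg hg0 hZ s hs)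
  have hsm : ∀ T, Summable fun p => if X p ≤ T then m p else 0 :=
    cnt_summable X m hm0 (η + 1) (by linarith) (hms _ (by linarith))
  have hsn : ∀ T, Summable fun p => if X p ≤ T then n p else 0 := by
    intro T
    refine Summable.of_nonneg_of_le (fun p => ?_) (fun p => ?_) ((hsm T).mul_left (1 / l₀))
    · have := hn0 p; split_ifs <;> simp [this]
    · split_ifs
      · rw [one_div, ← div_eq_inv_mul, le_div_iff₀ hl₀, mul_comm]
        exact mul_le_mul_of_nonneg_right (hl _) (hn0 p)
      · simp
  refine ⟨hsn, ?_⟩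
  obtain ⟨hsP, hP⟩ := cnt_partial X m l₀ hl₀ hXl hm0 hsm η hη hψ
  have hmX : ∀ p, m p / X p = n p / ((p.2 : ℝ) + 1) := fun p => by
    have := (hlpos p.1).ne'
    simp only [hm, hX, hn]; field_simp
  have hmX0 : ∀ p, 0 ≤ m p / X p := fun p => by
    rw [hmX]; have := hn0 p; positivity
  -- smallness of the normalised weights
  have hsmall : ∀ ε > 0, ∃ M, ∀ γ, M ≤ l γ → w γ ≤ ε * Real.exp (η * l γ) := by
    intro ε hε
    obtain ⟨M, hM⟩ := cnt_jump X m hm0 hsm η hη hψ (ε * l₀) (by positivity)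
    refine ⟨M, fun γ hγ => ?_⟩
    have h1 := hM (γ, 0) (by simpa [hX] using hγ)
    simp only [hm, hX, Nat.cast_zero, zero_add, one_mul, pow_one] at h1
    have h2 : l₀ * w γ ≤ l γ * w γ := mul_le_mul_of_nonneg_right (hl γ) (hw γ)
    refine le_of_mul_le_mul_left ?_ hl₀
    linarith
  have hlt1 : ∀ γ, w γ * Real.exp (-η * l γ) < 1 := by
    intro γ
    by_contra hcon
    have hcon := not_lt.1 hcon
    obtain ⟨M, hM⟩ := cnt_jump X m hm0 hsm η hη hψ (l₀ / 2) (by positivity)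
    obtain ⟨k, hk⟩ := exists_nat_ge (M / l₀)
    have h0 : M ≤ X (γ, k) := by
      have h1 : M ≤ k * l₀ := by rwa [div_le_iff₀ hl₀] at hk
      have h2 : (k : ℝ) * l₀ ≤ k * l γ := mul_le_mul_of_nonneg_left (hl γ) (Nat.cast_nonneg _)
      have := hlpos γ
      simp only [hX]; linarith
    have h1 := hM (γ, k) h0
    have h2 : Real.exp (η * X (γ, k)) ≤ w γ ^ (k + 1) := by
      have h3 : Real.exp (η * l γ) ≤ w γ := by
        have := mul_le_mul_of_nonneg_right hcon (Real.exp_pos (η * l γ)).le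
        rw [mul_assoc, ← Real.exp_add] at this
        simpa using this
      calc Real.exp (η * X (γ, k)) = Real.exp (η * l γ) ^ (k + 1) := by
            rw [← Real.exp_nat_mul]; simp only [hX]; push_cast; ring_nf
        _ ≤ _ := pow_le_pow_left₀ (Real.exp_pos _).le h3 _
    have h4 : l₀ * Real.exp (η * X (γ, k)) ≤ m (γ, k) := by
      simp only [hm]
      exact mul_le_mul (hl γ) h2 (Real.exp_pos _).le (hlpos γ).le
    have := Real.exp_pos (η * X (γ, k))
    nlinarith
  have hback : ∀ γ q, w γ * Real.exp (-η * l γ) ≤ q → w γ ≤ q * Real.exp (η * l γ) := by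
    intro γ q h
    have := mul_le_mul_of_nonneg_right h (Real.exp_pos (η * l γ)).le
    rw [mul_assoc, ← Real.exp_add] at this
    simpa using this
  obtain ⟨q, hq0, hq1, hq⟩ : ∃ q, 0 ≤ q ∧ q < 1 ∧ ∀ γ, w γ ≤ q * Real.exp (η * l γ) := by
    have hfin : {γ | 1 / 2 < w γ * Real.exp (-η * l γ)}.Finite := by
      obtain ⟨M, hM⟩ := hsmall (1 / 2) (by norm_num)
      have h1 := (hsm M).tendsto_cofinite_zero.eventually (gt_mem_nhds (show 0 < l₀ / 2 by positivity))
      have h2 : {p : L × ℕ | ¬ (if X p ≤ M then m p else 0) < l₀ / 2}.Finite := h1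
      refine (h2.preimage (f := fun γ : L => (γ, 0)) (fun a _ b _ h => by simpa using h)).subset ?_
      intro γ hγ
      have hγ : 1 / 2 < w γ * Real.exp (-η * l γ) := hγ
      have h3 : 1 / 2 * Real.exp (η * l γ) < w γ := by
        have := mul_lt_mul_of_pos_right hγ (Real.exp_pos (η * l γ))
        rw [mul_assoc (w γ), ← Real.exp_add] at this
        simpa using this
      have h4 : l γ < M := by
        by_contra hc
        exact absurd (hM γ (not_lt.1 hc)) (not_le.2 h3)
      have h5 : (1:ℝ) ≤ Real.exp (η * l γ) := Real.one_le_exp (mul_nonneg hη.le (hlpos γ).le)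
      simp only [mem_preimage, mem_setOf_eq, hX, hm, Nat.cast_zero, zero_add, one_mul, pow_one,
        if_pos h4.le, not_lt]
      have := hl γ
      nlinarith
    rcases Set.eq_empty_or_nonempty {γ | 1 / 2 < w γ * Real.exp (-η * l γ)} with he | hne
    · refine ⟨1 / 2, by norm_num, by norm_num, fun γ => hback γ _ ?_⟩
      by_contra hc
      have : γ ∈ {γ | 1 / 2 < w γ * Real.exp (-η * l γ)} := not_le.1 hc
      rw [he] at this
      exact this
    · obtain ⟨γ₀, hγ₀, hmax⟩ := Set.exists_max_image _ (fun γ => w γ * Real.exp (-η * l γ)) hfin hne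
      have hγ₀ : 1 / 2 < w γ₀ * Real.exp (-η * l γ₀) := hγ₀
      refine ⟨w γ₀ * Real.exp (-η * l γ₀), by linarith, hlt1 γ₀, fun γ => hback γ _ ?_⟩
      by_cases hc : 1 / 2 < w γ * Real.exp (-η * l γ)
      · exact hmax γ hc
      · linarith [not_lt.1 hc]
  -- Chebyshev bound
  obtain ⟨C, hC0, hC⟩ : ∃ C, 0 ≤ C ∧ ∀ T, 0 < T →
      (∑' γ, if l γ ≤ T then w γ else 0) ≤ C * Real.exp (η * T) / T := by
    obtain ⟨T₀, hT₀⟩ := eventually_atTop.1 (hP.eventually (gt_mem_nhds (show (1:ℝ) < 2 by norm_num)))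
    set P := cnt X (fun p => m p / X p) with hPdef
    have hPmono : Monotone P := cnt_mono X _ hmX0 hsP
    have hP0 : ∀ T, 0 ≤ P T := cnt_nonneg X _ hmX0
    refine ⟨max (2 / η) (P T₀ * T₀), le_max_of_le_left (by positivity), fun T hT => ?_⟩
    have h1 : (∑' γ, if l γ ≤ T then w γ else 0) ≤ P T := by
      have := tsum_comp_le_tsum_of_inj (hsP T)
        (fun p => by have := hmX0 p; split_ifs <;> simp [this]) (i := fun γ : L => (γ, 0)) (fun a b h => by simpa using h)
      refine le_trans (le_of_eq (tsum_congr fun γ => ?_)) this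
      have hl1 := (hlpos γ).ne'
      simp [hX, hm, mul_div_cancel_left₀ _ hl1]
    refine h1.trans ?_
    rw [le_div_iff₀ hT]
    rcases le_total T₀ T with h | h
    · have h2 := (hT₀ T h).le
      have h3 : P T * T ≤ 2 / η * Real.exp (η * T) := by
        have h4 := mul_le_mul_of_nonneg_right h2 (Real.exp_pos (η * T)).le
        have h5 : Real.exp (-η * T) * Real.exp (η * T) = 1 := by rw [← Real.exp_add]; simp
        have h6 : P T * (η * T * Real.exp (-η * T)) * Real.exp (η * T) = P T * T * η := by
          linear_combination (P T * η * T) * h5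
        rw [h6] at h4
        rw [div_mul_eq_mul_div, le_div_iff₀ hη]
        exact h4
      exact h3.trans (mul_le_mul_of_nonneg_right (le_max_left _ _) (Real.exp_pos _).le)
    · have h2 : P T * T ≤ P T₀ * T₀ := mul_le_mul (hPmono h) h hT.le (hP0 _)
      have h3 : (1:ℝ) ≤ Real.exp (η * T) := Real.one_le_exp (by positivity)
      have h4 : 0 ≤ P T₀ * T₀ := mul_nonneg (hP0 _) (by linarith)
      have h5 : P T₀ * T₀ ≤ max (2 / η) (P T₀ * T₀) := le_max_right _ _
      nlinarith
  have hR := iterates_negligible l w l₀ hl₀ hl hw η hη hsn q hq0 hq1 hq hsmall C hC0 hC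
  have hup := hP.add (hR.const_mul η)
  rw [mul_zero, add_zero] at hup
  refine tendsto_of_tendsto_of_tendsto_of_le_of_le' hP hup ?_ ?_
  · filter_upwards [eventually_gt_atTop 0] with T hT
    refine mul_le_mul_of_nonneg_right ?_ (by positivity)
    refine Summable.tsum_le_tsum (fun p => ?_) (hsP T) (hsn T)
    split_ifs
    · show m p / X p ≤ n p
      rw [hmX]
      refine div_le_self (hn0 p) ?_
      have : (0:ℝ) ≤ p.2 := Nat.cast_nonneg _
      linarith
    · exact le_rfl
  · filter_upwards [eventually_gt_atTop 0] with T hT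
    have hsR : Summable fun p : L × ℕ => if ((p.2 : ℝ) + 1) * l p.1 ≤ T ∧ p.2 ≠ 0 then w p.1 ^ (p.2 + 1) else 0 := by
      refine Summable.of_nonneg_of_le (fun p => ?_) (fun p => ?_) (hsn T)
      · have := hn0 p; split_ifs <;> simp_all
      · have h0 := hn0 p
        by_cases h : ((p.2 : ℝ) + 1) * l p.1 ≤ T
        · simp only [hX, h, true_and, if_true]; split_ifs
          · exact le_rfl
          · exact h0
        · simp [hX, h]
    have h1 : cnt X n T ≤ cnt X (fun p => m p / X p) T +
        ∑' p : L × ℕ, if ((p.2 : ℝ) + 1) * l p.1 ≤ T ∧ p.2 ≠ 0 then w p.1 ^ (p.2 + 1) else 0 := by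
      unfold cnt
      rw [← (hsP T).tsum_add hsR]
      refine Summable.tsum_le_tsum (fun p => ?_) (hsn T) ((hsP T).add hsR)
      by_cases h : ((p.2 : ℝ) + 1) * l p.1 ≤ T
      · have h' : X p ≤ T := h
        by_cases hk : p.2 = 0
        · simp only [h', if_true, hmX]
          simp [hk]
        · simp only [h', h, if_true, true_and, ne_eq, hk, not_false_eq_true]
          have := hmX0 p
          simp only [hn]; linarith
      · have h' : ¬ X p ≤ T := h
        simp [h, h']
    have h2 := mul_le_mul_of_nonneg_right h1 (show 0 ≤ η * T * Real.exp (-η * T) by positivity)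
    linarith

lemma cnt_convert {L : Type*} (l u : L → ℝ) (η T : ℝ) :
    cnt (fun p : L × ℕ => ((p.2 : ℝ) + 1) * l p.1) (fun p => u p.1 ^ (p.2 + 1)) T *
      (η * T * Real.exp (-η * T)) =
    (∑' p : {p : L × ℕ // ((p.2 : ℝ) + 1) * l p.1 ≤ T},
            u p.1.1 ^ (p.1.2 + 1)) / (Real.exp (η * T) / (η * T)) := by
  have h := tsum_subtype {p : L × ℕ | ((p.2 : ℝ) + 1) * l p.1 ≤ T} (fun p => u p.1 ^ (p.2 + 1))
  have h2 : cnt (fun p : L × ℕ => ((p.2 : ℝ) + 1) * l p.1) (fun p => u p.1 ^ (p.2 + 1)) T =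
      ∑' p : {p : L × ℕ // ((p.2 : ℝ) + 1) * l p.1 ≤ T}, u p.1.1 ^ (p.1.2 + 1) := by
    refine Eq.trans ?_ h.symm
    unfold cnt
    refine tsum_congr fun p => ?_
    simp [Set.indicator_apply]
  rw [h2, neg_mul, Real.exp_neg, div_div_eq_mul_div, div_eq_mul_inv]
  ring

end Helpers

/-- Comparison of asymptotically exponentially close weights (part 2):
under the same hypotheses as part 1 and `η > 0`, both weighted counting
functions satisfy `Σ_{k·l(γ) ≤ T} u(γ)^k ∼ e^{ηT}/(ηT)` for `u = w, v`. -/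
theorem close_weights_counting_asymptotics
    {L : Type*} [Countable L] (l : L → ℝ) (l₀ : ℝ) (hl₀ : 0 < l₀)
    (hl : ∀ γ, l₀ ≤ l γ) (w v : L → ℝ) (hw : ∀ γ, 0 ≤ w γ) (hv : ∀ γ, 0 ≤ v γ)
    (C ε : ℝ) (hC : 0 < C) (hε : 0 < ε) (r : L → ℕ → ℝ)
    (hr : ∀ γ : L, ∀ k : ℕ,
      v γ ^ (k + 1) = w γ ^ (k + 1) * (1 + r γ k) ∧
      |r γ k| ≤ C * Real.exp (-ε * ((k : ℝ) + 1) * l γ))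
    (η : ℝ) (hη : 0 < η)
    (hconv : ∀ σ : ℝ, η < σ →
      Summable (fun p : L × ℕ =>
        w p.1 ^ (p.2 + 1) * Real.exp (-((p.2 : ℝ) + 1) * σ * l p.1) /
          ((p.2 : ℝ) + 1)))
    (hext : ∃ U : Set ℂ, IsOpen U ∧ {s : ℂ | η ≤ s.re} ⊆ U ∧
      ∃ g : ℂ → ℂ, AnalyticOnNhd ℂ g U ∧ (∀ s ∈ U, g s ≠ 0) ∧
        ∀ s ∈ U, η < s.re →
          Complex.exp (zetaLog l w s) = g s / (s - (η : ℂ))) :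
    Filter.Tendsto
      (fun T : ℝ =>
        (∑' p : {p : L × ℕ // ((p.2 : ℝ) + 1) * l p.1 ≤ T},
            w p.1.1 ^ (p.1.2 + 1)) / (Real.exp (η * T) / (η * T)))
      Filter.atTop (nhds 1) ∧
    Filter.Tendsto
      (fun T : ℝ =>
        (∑' p : {p : L × ℕ // ((p.2 : ℝ) + 1) * l p.1 ≤ T},
            v p.1.1 ^ (p.1.2 + 1)) / (Real.exp (η * T) / (η * T)))
      Filter.atTop (nhds 1) := by
  have hlpos : ∀ γ, 0 < l γ := fun γ => hl₀.trans_le (hl γ)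
  obtain ⟨hsn, hlim⟩ := count_main l l₀ hl₀ hl w hw η hη hconv (zetaLog l w) (fun s => rfl) hext
  refine ⟨?_, ?_⟩
  · refine hlim.congr fun T => ?_
    exact cnt_convert l w η T
  · have hv' := cnt_perturb (fun p : L × ℕ => ((p.2 : ℝ) + 1) * l p.1)
      (fun p => w p.1 ^ (p.2 + 1)) (fun p => v p.1 ^ (p.2 + 1))
      (fun p => mul_nonneg (by positivity) (hlpos _).le) (fun p => pow_nonneg (hw _) _)
      hsn η hη hlim C ε hC hε (fun p => by
        obtain ⟨h1, h2⟩ := hr p.1 p.2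
        have hwp : 0 ≤ w p.1 ^ (p.2 + 1) := pow_nonneg (hw _) _
        have e : v p.1 ^ (p.2 + 1) - w p.1 ^ (p.2 + 1) = w p.1 ^ (p.2 + 1) * r p.1 p.2 := by
          rw [h1]; ring
        show |v p.1 ^ (p.2 + 1) - w p.1 ^ (p.2 + 1)| ≤
          C * (w p.1 ^ (p.2 + 1) * Real.exp (-ε * (((p.2 : ℝ) + 1) * l p.1)))
        rw [e, abs_mul, abs_of_nonneg hwp, ← mul_assoc (-ε)]
        have h3 := mul_le_mul_of_nonneg_left h2 hwp
        linarith)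
    refine hv'.congr fun T => ?_
    exact cnt_convert l v η T
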